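/- arXiv:1305.6008 — 2 statements merged into one kernel-verified Lean document; each statement's English description precedes it below -/
import Mathlib

section
/- Measurability of the quasi-sure support and its polar cone (Lemma 4.3): Let Ω and Ω₁ be Polish spaces, let 𝒫 : Ω ↠ 𝔓(Ω₁) be a set-valued map with nonempty values whose graph is an analytic subset of Ω × 𝔓(Ω₁), and let X : Ω × Ω₁ → ℝ^d be Borel. Define Λ(ω) := supp_{𝒫(ω)}(X(ω,·)) ⊆ ℝ^d, the smallest closed set carrying full measure under every law P ∘ X(ω,·)⁻¹, P ∈ 𝒫(ω). Then: (1) Λ is closed-valued and universally measurable as a set-valued map (i.e., {ω : Λ(ω) ∩ A ≠ ∅} is universally measurable for every closed A ⊆ ℝ^d); (2) the polar cone Λ°(ω) := {y ∈ ℝ^d : y·v ≥ 0 for all v ∈ Λ(ω)} is nonempty-closed-valued and universally measurable; and (3) for every ω ∈ Ω, Λ°(ω) = {y ∈ ℝ^d : y·X(ω,·) ≥ 0 𝒫(ω)-q.s.}. -/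
open MeasureTheory Set Filter Topology
open scoped ENNReal NNReal

noncomputable section

namespace BN

/-- The universal completion of the ambient measurable structure on `α`:
a set is measurable iff it is null-measurable for every probability measure. -/
def univComp (α : Type*) [MeasurableSpace α] : MeasurableSpace α where
  MeasurableSet' s := ∀ μ : Measure α, IsProbabilityMeasure μ → NullMeasurableSet s μ
  measurableSet_empty := fun _ _ => MeasurableSet.empty.nullMeasurableSet
  measurableSet_compl := fun _ hs μ hμ => (hs μ hμ).compl
  measurableSet_iUnion := fun _ hf μ hμ => NullMeasurableSet.iUnion fun i => hf i μ hμ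

/-- `N` is `PP`-polar: it is contained in an `m`-measurable set which is null under
every `P ∈ PP`. -/
def IsPolar {α : Type*} [MeasurableSpace α] (PP : Set (Measure α)) (m : MeasurableSpace α)
    (N : Set α) : Prop :=
  ∃ A : Set α, MeasurableSet[m] A ∧ N ⊆ A ∧ ∀ P ∈ PP, P A = 0

/-- A property holds `PP`-quasi surely if its complement is `PP`-polar. -/
def QuasiSure {α : Type*} [mα : MeasurableSpace α] (PP : Set (Measure α))
    (m : MeasurableSpace α) (p : α → Prop) : Prop :=
  @IsPolar α mα PP m {ω | ¬ p ω}

/-- Expectation of a real random variable, with the convention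
`E[f] = E[f⁺] - E[f⁻]` and `∞ - ∞ = -∞` (which holds in `EReal`). -/
def expec {α : Type*} [MeasurableSpace α] (Q : Measure α) (f : α → ℝ) : EReal :=
  ((∫⁻ x, ENNReal.ofReal (f x) ∂Q : ℝ≥0∞) : EReal)
    - ((∫⁻ x, ENNReal.ofReal (-f x) ∂Q : ℝ≥0∞) : EReal)

/-- Positive part of an extended real, valued in `ℝ≥0∞`. -/
def posE (x : EReal) : ℝ≥0∞ := if x = ⊤ then ⊤ else ENNReal.ofReal x.toReal

/-- Expectation of an extended-real random variable, with the convention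
`E[f] = E[f⁺] - E[f⁻]` and `∞ - ∞ = -∞`. -/
def eexpec {α : Type*} [MeasurableSpace α] (Q : Measure α) (f : α → EReal) : EReal :=
  ((∫⁻ x, posE (f x) ∂Q : ℝ≥0∞) : EReal) - ((∫⁻ x, posE (-(f x)) ∂Q : ℝ≥0∞) : EReal)

/-- A real-valued function is upper semianalytic if all its strict superlevel sets
are analytic. -/
def UpperSemianalytic {α : Type*} [TopologicalSpace α] (f : α → ℝ) : Prop :=
  ∀ c : ℝ, AnalyticSet {x | c < f x}

/-- An extended-real-valued function is upper semianalytic if all its strict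
superlevel sets `{f > c}`, `c ∈ ℝ`, are analytic. -/
def UpperSemianalyticE {α : Type*} [TopologicalSpace α] (f : α → EReal) : Prop :=
  ∀ c : ℝ, AnalyticSet {x | (c : EReal) < f x}

/-- Convexity of a set of probability measures. -/
def ConvexPM {α : Type*} [MeasurableSpace α] (C : Set (ProbabilityMeasure α)) : Prop :=
  ∀ μ ∈ C, ∀ ν ∈ C, ∀ a b : ℝ≥0∞, a + b = 1 →
    ∀ ξ : ProbabilityMeasure α, (ξ : Measure α) = a • (μ : Measure α) + b • (ν : Measure α) →
      ξ ∈ C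

/-! ### The general (non-Polish) setting of Section 2 -/

section General

variable {Ω : Type*} [MeasurableSpace Ω]

/-- Predictability of a trading strategy `H` with respect to a filtration `F`:
the holding `H (u+1)` over the period `(u, u+1]` is `F u`-measurable. -/
def PredictableF (F : ℕ → MeasurableSpace Ω) (T d : ℕ) (H : ℕ → Ω → Fin d → ℝ) : Prop :=
  ∀ u : ℕ, u < T → Measurable[F u] (H (u + 1))

/-- The final gain `(H · S)_T` from trading `H` in the stocks `S`. -/
def gainF {d : ℕ} (S : ℕ → Ω → Fin d → ℝ) (H : ℕ → Ω → Fin d → ℝ) (T : ℕ) (ω : Ω) : ℝ :=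
  ∑ u : Fin T, ∑ i : Fin d, H (u + 1) ω i * (S (u + 1) ω i - S u ω i)

/-- The no-arbitrage condition `NA(PP)` (no options). -/
def NAF (F : ℕ → MeasurableSpace Ω) (T d : ℕ) (S : ℕ → Ω → Fin d → ℝ)
    (PP : Set (Measure Ω)) : Prop :=
  ∀ H : ℕ → Ω → Fin d → ℝ, PredictableF F T d H →
    QuasiSure PP ‹MeasurableSpace Ω› (fun ω => 0 ≤ gainF S H T ω) →
      QuasiSure PP ‹MeasurableSpace Ω› (fun ω => gainF S H T ω = 0)

/-- The cone `𝒞` of claims superreplicable from zero initial capital. -/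
def Cset (F : ℕ → MeasurableSpace Ω) (T d : ℕ) (S : ℕ → Ω → Fin d → ℝ) : Set (Ω → ℝ) :=
  {W | ∃ H : ℕ → Ω → Fin d → ℝ, PredictableF F T d H ∧
    ∃ K : Ω → ℝ, Measurable K ∧ (∀ ω, 0 ≤ K ω) ∧ ∀ ω, W ω = gainF S H T ω - K ω}

/-- The superhedging price (no options), with values in `EReal` (`inf ∅ = +∞`). -/
def superPriceF (F : ℕ → MeasurableSpace Ω) (T d : ℕ) (S : ℕ → Ω → Fin d → ℝ)
    (PP : Set (Measure Ω)) (f : Ω → ℝ) : EReal :=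
  sInf ((fun x : ℝ => (x : EReal)) ''
    {x : ℝ | ∃ H : ℕ → Ω → Fin d → ℝ, PredictableF F T d H ∧
      QuasiSure PP ‹MeasurableSpace Ω› (fun ω => f ω ≤ x + gainF S H T ω)})

end General

/-! ### The one-period setting of Section 3 -/

section OnePeriod

variable {Ω : Type*} [MeasurableSpace Ω] {d : ℕ}

/-- One-period no-arbitrage condition `NA(PP)` for the increment `ΔS`. -/
def NA1 (PP : Set (Measure Ω)) (ΔS : Ω → Fin d → ℝ) : Prop :=
  ∀ y : Fin d → ℝ,
    QuasiSure PP ‹MeasurableSpace Ω› (fun ω => 0 ≤ ∑ i, y i * ΔS ω i) →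
      QuasiSure PP ‹MeasurableSpace Ω› (fun ω => ∑ i, y i * ΔS ω i = 0)

/-- The martingale measures dominated by `PP` in the one-period market:
`𝒬 = {Q : Q ⋘ 𝒫, E_Q[ΔS] = 0}`. -/
def Q1set (PP : Set (Measure Ω)) (ΔS : Ω → Fin d → ℝ) : Set (Measure Ω) :=
  {Q | IsProbabilityMeasure Q ∧ (∃ P ∈ PP, Q ≪ P) ∧
    ∀ i, expec Q (fun ω => ΔS ω i) = 0}

/-- One-period superhedging price, with values in `EReal` (`inf ∅ = +∞`). -/
def superPrice1 (PP : Set (Measure Ω)) (ΔS : Ω → Fin d → ℝ) (f : Ω → ℝ) : EReal :=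
  sInf ((fun x : ℝ => (x : EReal)) ''
    {x : ℝ | ∃ H : Fin d → ℝ,
      QuasiSure PP ‹MeasurableSpace Ω› (fun ω => f ω ≤ x + ∑ i, H i * ΔS ω i)})

end OnePeriod

/-! ### The Polish multi-period setting -/

section Polish

variable (Ω₁ : Type) [MeasurableSpace Ω₁]

/-- Restriction of a path up to time `t`. -/
def restr {T : ℕ} (t : ℕ) (h : t ≤ T) (ω : Fin T → Ω₁) : Fin t → Ω₁ :=
  fun i => ω (Fin.castLE h i)

/-- Universally measurable predictability: `H u` (the holding over `(u, u+1]`)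
is a universally measurable function of the first `u` coordinates. -/
def Pred (d : ℕ) (H : (u : ℕ) → (Fin u → Ω₁) → Fin d → ℝ) : Prop :=
  ∀ u : ℕ, @Measurable _ _ (univComp (Fin u → Ω₁)) _ (H u)

/-- The gain `(H · S)_t = ∑_{u=1}^t H_u (S_u - S_{u-1})` up to time `t ≤ T`. -/
def gain {T d : ℕ} (S : (t : ℕ) → (Fin t → Ω₁) → Fin d → ℝ)
    (H : (u : ℕ) → (Fin u → Ω₁) → Fin d → ℝ) (t : ℕ) (h : t ≤ T) (ω : Fin T → Ω₁) : ℝ :=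
  ∑ u : Fin t, ∑ i : Fin d,
    H u (restr Ω₁ u (u.2.le.trans h) ω) i *
      (S (u + 1) (restr Ω₁ (u + 1) (Nat.succ_le_of_lt (u.2.trans_le h)) ω) i
        - S u (restr Ω₁ u (u.2.le.trans h) ω) i)

variable [TopologicalSpace Ω₁] [OpensMeasurableSpace Ω₁]

/-- The set `PP = {P₀ ⊗ ⋯ ⊗ P_{t-1}}` of measures built from universally
measurable selectors of the one-step collections `𝒫_s(·)`. -/
def MeasFam (Pt : (t : ℕ) → (Fin t → Ω₁) → Set (ProbabilityMeasure Ω₁)) :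
    (t : ℕ) → Set (Measure (Fin t → Ω₁))
  | 0 => {μ | μ = Measure.dirac Fin.elim0}
  | (t + 1) => {μ | ∃ ν ∈ MeasFam Pt t, ∃ κ : (Fin t → Ω₁) → ProbabilityMeasure Ω₁,
      @Measurable _ _ (univComp (Fin t → Ω₁)) (borel (ProbabilityMeasure Ω₁)) κ ∧
      (∀ ω, κ ω ∈ Pt t ω) ∧
      μ = ν.bind (fun ω => Measure.map (Fin.snoc ω) (κ ω : Measure Ω₁))}

/-- The σ-field `ℱ_t` on `Ω = Ω₁^T`: the comap under the restriction map of the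
universal completion of the Borel σ-field of `Ω₁^t`. -/
def filtr (T : ℕ) (t : ℕ) (h : t ≤ T) : MeasurableSpace (Fin T → Ω₁) :=
  MeasurableSpace.comap (restr Ω₁ t h) (univComp (Fin t → Ω₁))

/-- `S` is a `Q`-martingale with respect to the filtration `(ℱ_t)`. -/
def IsMartMeas {T d : ℕ} (S : (t : ℕ) → (Fin t → Ω₁) → Fin d → ℝ)
    (Q : Measure (Fin T → Ω₁)) : Prop :=
  (∀ (t : ℕ) (h : t ≤ T) (i : Fin d), Integrable (fun ω => S t (restr Ω₁ t h ω) i) Q) ∧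
  (∀ (t : ℕ) (h : t + 1 ≤ T) (i : Fin d) (A : Set (Fin T → Ω₁)),
    MeasurableSet[filtr Ω₁ T t ((Nat.le_succ t).trans h)] A →
      ∫ ω in A, S (t + 1) (restr Ω₁ (t + 1) h ω) i ∂Q
        = ∫ ω in A, S t (restr Ω₁ t ((Nat.le_succ t).trans h) ω) i ∂Q)

/-- The martingale measures `Q ⋘ PP` consistent with the option prices:
`𝒬 = {Q ⋘ PP : S is a Q-martingale, E_Q[gⁱ] = 0}`. -/
def QSet {T d e : ℕ} (PP : Set (Measure (Fin T → Ω₁)))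
    (S : (t : ℕ) → (Fin t → Ω₁) → Fin d → ℝ) (g : Fin e → (Fin T → Ω₁) → ℝ) :
    Set (Measure (Fin T → Ω₁)) :=
  {Q | IsProbabilityMeasure Q ∧ (∃ P ∈ PP, Q ≪ P) ∧ IsMartMeas Ω₁ S Q ∧
    ∀ i : Fin e, expec Q (g i) = 0}

/-- The no-arbitrage condition `NA(PP)` with semistatic trading in the stocks `S`
and the options `g`. -/
def NA {T d e : ℕ} (PP : Set (Measure (Fin T → Ω₁)))
    (S : (t : ℕ) → (Fin t → Ω₁) → Fin d → ℝ) (g : Fin e → (Fin T → Ω₁) → ℝ) : Prop :=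
  ∀ H : (u : ℕ) → (Fin u → Ω₁) → Fin d → ℝ, Pred Ω₁ d H → ∀ h : Fin e → ℝ,
    QuasiSure PP (univComp (Fin T → Ω₁))
      (fun ω => 0 ≤ gain Ω₁ S H T le_rfl ω + ∑ i, h i * g i ω) →
    QuasiSure PP (univComp (Fin T → Ω₁))
      (fun ω => gain Ω₁ S H T le_rfl ω + ∑ i, h i * g i ω = 0)

/-- The minimal semistatic superhedging price, valued in `EReal` (`inf ∅ = +∞`). -/
def superPrice {T d e : ℕ} (PP : Set (Measure (Fin T → Ω₁)))
    (S : (t : ℕ) → (Fin t → Ω₁) → Fin d → ℝ) (g : Fin e → (Fin T → Ω₁) → ℝ)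
    (f : (Fin T → Ω₁) → ℝ) : EReal :=
  sInf ((fun x : ℝ => (x : EReal)) ''
    {x : ℝ | ∃ H : (u : ℕ) → (Fin u → Ω₁) → Fin d → ℝ, ∃ h : Fin e → ℝ, Pred Ω₁ d H ∧
      QuasiSure PP (univComp (Fin T → Ω₁))
        (fun ω => f ω ≤ x + gain Ω₁ S H T le_rfl ω + ∑ i, h i * g i ω)})

/-- `f` is replicable by semistatic trading. -/
def Replicable {T d e : ℕ} (PP : Set (Measure (Fin T → Ω₁)))
    (S : (t : ℕ) → (Fin t → Ω₁) → Fin d → ℝ) (g : Fin e → (Fin T → Ω₁) → ℝ)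
    (f : (Fin T → Ω₁) → ℝ) : Prop :=
  ∃ x : ℝ, ∃ H : (u : ℕ) → (Fin u → Ω₁) → Fin d → ℝ, ∃ h : Fin e → ℝ, Pred Ω₁ d H ∧
    QuasiSure PP (univComp (Fin T → Ω₁))
      (fun ω => x + gain Ω₁ S H T le_rfl ω + ∑ i, h i * g i ω = f ω)

/-- The one-period increment `ΔS_{t+1}(ω, ·)` of the stock, given history `ω ∈ Ω_t`. -/
def incr {d : ℕ} (S : (t : ℕ) → (Fin t → Ω₁) → Fin d → ℝ) (t : ℕ) (ω : Fin t → Ω₁)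
    (x : Ω₁) : Fin d → ℝ :=
  fun i => S (t + 1) (Fin.snoc ω x) i - S t ω i

/-- The one-step martingale measures `𝒬_t(ω)` dominated by `𝒫_t(ω)`. -/
def Q1fam {d : ℕ} (Pt : (t : ℕ) → (Fin t → Ω₁) → Set (ProbabilityMeasure Ω₁))
    (S : (t : ℕ) → (Fin t → Ω₁) → Fin d → ℝ) (t : ℕ) (ω : Fin t → Ω₁) :
    Set (ProbabilityMeasure Ω₁) :=
  {Q | (∃ P' ∈ Pt t ω, (Q : Measure Ω₁) ≪ (P' : Measure Ω₁)) ∧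
    ∀ i, expec (Q : Measure Ω₁) (fun x => incr Ω₁ S t ω x i) = 0}

/-- `V` is a `Q`-supermartingale with respect to the filtration `(ℱ_t)`:
each `V_t` is `Q`-integrable and `E_Q[V_{t+1} | ℱ_t] ≤ V_t`. -/
def IsSupermart {T : ℕ} (V : ℕ → (Fin T → Ω₁) → ℝ) (Q : Measure (Fin T → Ω₁)) : Prop :=
  (∀ t : ℕ, t ≤ T → Integrable (V t) Q) ∧
  ∀ (t : ℕ) (h : t + 1 ≤ T) (A : Set (Fin T → Ω₁)),
    MeasurableSet[filtr Ω₁ T t ((Nat.le_succ t).trans h)] A →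
      ∫ ω in A, V (t + 1) ω ∂Q ≤ ∫ ω in A, V t ω ∂Q

end Polish

/-! ### Quasi-sure supports -/

/-- The quasi-sure support of a family of measures on `ℝ^d`. -/
def qsSupp {d : ℕ} (Rs : Set (Measure (Fin d → ℝ))) : Set (Fin d → ℝ) :=
  ⋂₀ {A : Set (Fin d → ℝ) | IsClosed A ∧ ∀ R ∈ Rs, R A = 1}

end BN


/-- Inner regularity of continuous images of Baire space with respect to closed sets. -/
theorem exists_isClosed_subset_range_lt_measure {α : Type*} [TopologicalSpace α]
    [TopologicalSpace.PseudoMetrizableSpace α] [T2Space α] [MeasurableSpace α]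
    [OpensMeasurableSpace α] (μ : Measure α) [IsFiniteMeasure μ] {f : (ℕ → ℕ) → α}
    (hf : Continuous f) {c : ℝ≥0∞} (hc : c < μ (range f)) :
    ∃ K ⊆ range f, IsClosed K ∧ c ≤ μ K := by
  let := TopologicalSpace.pseudoMetrizableSpacePseudoMetric α
  have step : ∀ (D : {D : Set (ℕ → ℕ) // c < μ (f '' D)}) (k : ℕ),
      ∃ m : ℕ, c < μ (f '' (D.1 ∩ {z | z k ≤ m})) := by
    rintro ⟨D, hD⟩ k
    have hmono : Monotone fun m : ℕ => f '' (D ∩ {z | z k ≤ m}) := fun a b hab =>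
      image_mono (inter_subset_inter_right _ fun z (hz : z k ≤ a) => hz.trans hab)
    have hunion : ⋃ m : ℕ, f '' (D ∩ {z | z k ≤ m}) = f '' D := by
      rw [← image_iUnion, ← inter_iUnion]
      congr 1
      exact inter_eq_left.2 fun z _ => mem_iUnion.2 ⟨z k, le_refl (z k)⟩
    rw [← hunion, hmono.measure_iUnion] at hD
    exact lt_iSup_iff.1 hD
  choose m hm using step
  let D : ℕ → {D : Set (ℕ → ℕ) // c < μ (f '' D)} := fun k =>
    Nat.rec ⟨univ, by rwa [image_univ]⟩ (fun k D => ⟨D.1 ∩ {z | z k ≤ m D k}, hm D k⟩) k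
  have hDsucc : ∀ k, (D (k + 1)).1 = (D k).1 ∩ {z | z k ≤ m (D k) k} := fun _ => rfl
  have hDanti : Antitone fun k => (D k).1 :=
    antitone_nat_of_succ_le fun k => by rw [hDsucc]; exact inter_subset_left
  have hDle : ∀ {k i z}, i < k → z ∈ (D k).1 → z i ≤ m (D i) i := fun {k i z} hik hz => by
    have := hDanti (Nat.succ_le_of_lt hik) hz
    exact this.2
  refine ⟨⋂ k, closure (f '' (D k).1), ?_, isClosed_iInter fun _ => isClosed_closure, ?_⟩
  · intro x hx
    have hx' : ∀ k : ℕ, ∃ z ∈ (D k).1, dist x (f z) < 1 / ((k : ℝ) + 1) := fun k => by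
      obtain ⟨_, ⟨z, hz, rfl⟩, hd⟩ :=
        Metric.mem_closure_iff.1 (mem_iInter.1 hx k) (1 / ((k : ℝ) + 1)) Nat.one_div_pos_of_nat
      exact ⟨z, hz, hd⟩
    choose z hzD hzx using hx'
    have hL : IsCompact (Set.pi univ fun i => Iic (m (D i) i)) :=
      isCompact_univ_pi fun i => (finite_Iic _).isCompact
    obtain ⟨w, -, φ, hφ, hw⟩ := hL.tendsto_subseq
      (x := fun k i => min (z k i) (m (D i) i)) fun k i _ => mem_Iic.2 (min_le_right _ _)
    have hzw : Tendsto (z ∘ φ) atTop (𝓝 w) := by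
      rw [tendsto_pi_nhds] at hw ⊢
      intro i
      refine (hw i).congr' ?_
      filter_upwards [eventually_gt_atTop i] with k hk
      exact min_eq_left (hDle (hk.trans_le (hφ.id_le k)) (hzD _))
    have hfx : Tendsto (fun k => f (z k)) atTop (𝓝 x) := by
      refine tendsto_iff_dist_tendsto_zero.2 (squeeze_zero (fun _ => dist_nonneg)
        (fun k => ?_) tendsto_one_div_add_atTop_nhds_zero_nat)
      rw [dist_comm]
      exact (hzx k).le
    exact ⟨w, tendsto_nhds_unique ((hf.tendsto w).comp hzw) (hfx.comp hφ.tendsto_atTop)⟩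
  · rw [Antitone.measure_iInter (fun a b hab => closure_mono (image_mono (hDanti hab)))
      (fun _ => isClosed_closure.measurableSet.nullMeasurableSet) ⟨0, measure_ne_top _ _⟩]
    exact le_iInf fun k => (D k).2.le.trans (measure_mono subset_closure)

/-- Analytic sets are null-measurable for every finite Borel measure. -/
theorem analyticSet_nullMeasurableSet {α : Type*} [TopologicalSpace α]
    [TopologicalSpace.PseudoMetrizableSpace α] [T2Space α] [MeasurableSpace α]
    [OpensMeasurableSpace α] (μ : Measure α) [IsFiniteMeasure μ] {s : Set α}
    (hs : AnalyticSet s) : NullMeasurableSet s μ := by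
  rw [AnalyticSet] at hs
  obtain rfl | ⟨f, hf, rfl⟩ := hs
  · exact nullMeasurableSet_empty
  obtain h0 | hpos := eq_or_ne (μ (range f)) 0
  · exact NullMeasurableSet.of_null h0
  obtain ⟨c, -, hc, hlim⟩ := exists_seq_strictMono_tendsto' (pos_iff_ne_zero.2 hpos)
  choose K hKs hKc hcK using fun n => exists_isClosed_subset_range_lt_measure μ hf (hc n).2
  have hU : MeasurableSet (⋃ n, K n) := .iUnion fun n => (hKc n).measurableSet
  have hle : μ (range f) ≤ μ (⋃ n, K n) :=
    le_of_tendsto' hlim fun n => (hcK n).trans (measure_mono (subset_iUnion K n))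
  exact hU.nullMeasurableSet.congr (ae_eq_of_subset_of_measure_ge (iUnion_subset hKs) hle
    hU.nullMeasurableSet (measure_ne_top _ _))

/-- A weakly continuous family of probability measures is measurable for the Giry σ-field. -/
theorem measurable_toMeasure_of_continuous {β Ω₁ : Type*} [TopologicalSpace β]
    [MeasurableSpace β] [OpensMeasurableSpace β] [TopologicalSpace Ω₁] [MeasurableSpace Ω₁]
    [BorelSpace Ω₁] [HasOuterApproxClosed Ω₁] {g : β → ProbabilityMeasure Ω₁}
    (hg : Continuous g) : Measurable fun b => (g b : Measure Ω₁) := by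
  refine Measurable.measure_of_isPiSystem_of_isProbabilityMeasure
    (BorelSpace.measurable_eq (α := Ω₁)) isPiSystem_isOpen fun G hG => ?_
  refine LowerSemicontinuous.measurable (lowerSemicontinuous_iff_le_liminf.2 fun b => ?_)
  exact ProbabilityMeasure.le_liminf_measure_open_of_tendsto (hg.tendsto b) hG

/-- If a correspondence of probability measures has analytic graph, then the set of points at
which some measure of the family charges the section of a given Borel set is analytic. -/
theorem analyticSet_exists_measure_section_ne_zero {Ω Ω₁ : Type*} [MeasurableSpace Ω]
    [TopologicalSpace Ω] [BorelSpace Ω] [MeasurableSpace Ω₁] [TopologicalSpace Ω₁]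
    [BorelSpace Ω₁] [HasOuterApproxClosed Ω₁] {PP : Ω → Set (ProbabilityMeasure Ω₁)}
    (hgraph : AnalyticSet {p : Ω × ProbabilityMeasure Ω₁ | p.2 ∈ PP p.1})
    {B : Set (Ω × Ω₁)} (hB : MeasurableSet B) :
    AnalyticSet {ω | ∃ P ∈ PP ω, (P : Measure Ω₁) (Prod.mk ω ⁻¹' B) ≠ 0} := by
  obtain ⟨β, _, _, f, hf, hrange⟩ := analyticSet_iff_exists_polishSpace_range.1 hgraph
  borelize β
  let κ : ProbabilityTheory.Kernel β Ω₁ :=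
    ⟨fun b => ((f b).2 : Measure Ω₁), measurable_toMeasure_of_continuous hf.snd⟩
  have : ProbabilityTheory.IsMarkovKernel κ := ⟨fun b => inferInstanceAs
    (IsProbabilityMeasure ((f b).2 : Measure Ω₁))⟩
  have hmeas : Measurable fun b => κ b (Prod.mk b ⁻¹' {p : β × Ω₁ | ((f p.1).1, p.2) ∈ B}) :=
    ProbabilityTheory.Kernel.measurable_kernel_prodMk_left
      (((hf.fst.measurable.comp measurable_fst).prodMk measurable_snd) hB)
  have hS : MeasurableSet {b | κ b (Prod.mk b ⁻¹' {p : β × Ω₁ | ((f p.1).1, p.2) ∈ B}) ≠ 0} :=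
    hmeas (measurableSet_singleton 0).compl
  convert! hS.analyticSet.image_of_continuous hf.fst using 1
  ext ω
  constructor
  · rintro ⟨P, hP, hne⟩
    obtain ⟨b, hb⟩ : (ω, P) ∈ range f := hrange ▸ hP
    refine ⟨b, ?_, congrArg Prod.fst hb⟩
    change ((f b).2 : Measure Ω₁) (Prod.mk (f b).1 ⁻¹' B) ≠ 0
    rwa [hb]
  · rintro ⟨b, hb, rfl⟩
    have hmem : f b ∈ range f := mem_range_self b
    rw [hrange] at hmem
    exact ⟨(f b).2, hmem, hb⟩

namespace BN

theorem isClosed_qsSupp {d : ℕ} (Rs : Set (Measure (Fin d → ℝ))) : IsClosed (qsSupp Rs) :=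
  isClosed_sInter fun _ hA => hA.1

/-- An open set meets the quasi-sure support iff it is charged by some measure. -/
theorem qsSupp_inter_nonempty_iff {d : ℕ} {Rs : Set (Measure (Fin d → ℝ))}
    (hRs : ∀ R ∈ Rs, IsProbabilityMeasure R) {O : Set (Fin d → ℝ)} (hO : IsOpen O) :
    (qsSupp Rs ∩ O).Nonempty ↔ ∃ R ∈ Rs, R O ≠ 0 := by
  constructor
  · rintro ⟨v, hv, hvO⟩
    by_contra! h
    refine hv Oᶜ ⟨hO.isClosed_compl, fun R hR => ?_⟩ hvO
    have := hRs R hR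
    exact (prob_compl_eq_one_iff hO.measurableSet).2 (h R hR)
  · rintro ⟨R, hR, hRO⟩
    have := hRs R hR
    by_contra h
    refine hRO (measure_null_of_locally_null O fun v hv => ?_)
    have hv' : v ∉ qsSupp Rs := fun hv' => h ⟨v, hv', hv⟩
    simp only [qsSupp, mem_sInter, not_forall] at hv'
    obtain ⟨A, ⟨hA, hA1⟩, hvA⟩ := hv'
    exact ⟨Aᶜ, mem_nhdsWithin_of_mem_nhds (hA.isOpen_compl.mem_nhds hvA),
      (prob_compl_eq_zero_iff hA.measurableSet).2 (hA1 R hR)⟩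

theorem measurableSet_univComp_of_analyticSet {α : Type*} [TopologicalSpace α]
    [TopologicalSpace.PseudoMetrizableSpace α] [T2Space α] [MeasurableSpace α]
    [OpensMeasurableSpace α] {s : Set α} (hs : AnalyticSet s) : MeasurableSet[univComp α] s :=
  fun μ _ => analyticSet_nullMeasurableSet μ hs

end BN

/-- Measurability of a correspondence with values in a σ-compact space can be tested on
compact sets. -/
theorem measurableSet_inter_nonempty_of_isCompact {Ω E : Type*} [MeasurableSpace Ω]
    [TopologicalSpace E] [SigmaCompactSpace E] {Γ : Ω → Set E}
    (h : ∀ K : Set E, IsCompact K → MeasurableSet {ω | (Γ ω ∩ K).Nonempty})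
    {A : Set E} (hA : IsClosed A) : MeasurableSet {ω | (Γ ω ∩ A).Nonempty} := by
  have : {ω | (Γ ω ∩ A).Nonempty} =
      ⋃ n, {ω | (Γ ω ∩ (compactCovering E n ∩ A)).Nonempty} := by
    ext ω
    simp only [mem_ofPred_eq, mem_iUnion, ← nonempty_iUnion, ← inter_iUnion, ← iUnion_inter,
      iUnion_compactCovering, univ_inter]
  rw [this]
  exact .iUnion fun n => h _ ((isCompact_compactCovering E n).inter_right hA)

/-- A closed-valued correspondence that is measurable with respect to open sets is measurable
with respect to closed sets. -/
theorem measurableSet_inter_nonempty_of_isOpen {Ω E : Type*} [MeasurableSpace Ω]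
    [PseudoMetricSpace E] [SigmaCompactSpace E] {Γ : Ω → Set E} (hΓ : ∀ ω, IsClosed (Γ ω))
    (h : ∀ O : Set E, IsOpen O → MeasurableSet {ω | (Γ ω ∩ O).Nonempty})
    {A : Set E} (hA : IsClosed A) : MeasurableSet {ω | (Γ ω ∩ A).Nonempty} := by
  refine measurableSet_inter_nonempty_of_isCompact (fun K hK => ?_) hA
  have : {ω | (Γ ω ∩ K).Nonempty} =
      ⋂ n : ℕ, {ω | (Γ ω ∩ Metric.thickening (1 / ((n : ℝ) + 1)) K).Nonempty} := by
    ext ω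
    simp only [mem_ofPred_eq, mem_iInter]
    refine ⟨fun hω n => hω.mono (inter_subset_inter_right _
      (Metric.self_subset_thickening Nat.one_div_pos_of_nat K)), fun hω => ?_⟩
    by_contra hemp
    obtain ⟨δ, hδ, hdisj⟩ := (disjoint_iff_inter_eq_empty.2
      (not_nonempty_iff_eq_empty.1 hemp)).symm.exists_thickenings hK (hΓ ω)
    obtain ⟨n, hn⟩ := exists_nat_one_div_lt hδ
    obtain ⟨v, hvΓ, hvK⟩ := hω n
    exact disjoint_left.1 hdisj (Metric.thickening_mono hn.le K hvK)
      (Metric.self_subset_thickening hδ _ hvΓ)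
  rw [this]
  exact .iInter fun n => h _ Metric.isOpen_thickening

/-- The correspondence of points `y` satisfying a closed constraint against every point of a
measurable correspondence is measurable. -/
theorem measurableSet_dual_inter_nonempty {Ω E F : Type*} [MeasurableSpace Ω]
    [TopologicalSpace E] [SecondCountableTopology E] [TopologicalSpace F] [SigmaCompactSpace F]
    {Γ : Ω → Set E} (h : ∀ O : Set E, IsOpen O → MeasurableSet {ω | (Γ ω ∩ O).Nonempty})
    {C : Set (F × E)} (hC : IsClosed C) {A : Set F} (hA : IsClosed A) :
    MeasurableSet {ω | ({y | ∀ v ∈ Γ ω, (y, v) ∈ C} ∩ A).Nonempty} := by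
  refine measurableSet_inter_nonempty_of_isCompact (fun K hK => ?_) hA
  let B := TopologicalSpace.countableBasis E
  have hB := TopologicalSpace.isBasis_countableBasis E
  have : Countable B := (TopologicalSpace.countable_countableBasis E).to_subtype
  let N : B → Set F := fun U => interior {y | ∀ v ∈ U.1, (y, v) ∉ C}
  have key : {ω | ({y | ∀ v ∈ Γ ω, (y, v) ∈ C} ∩ K).Nonempty}ᶜ =
      ⋃ (t : Finset B) (_ : K ⊆ ⋃ U ∈ t, N U), ⋂ U ∈ t, {ω | (Γ ω ∩ U.1).Nonempty} := by
    ext ω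
    simp only [mem_compl_iff, mem_ofPred_eq, mem_iUnion, mem_iInter, exists_prop]
    constructor
    · intro hω
      obtain ⟨t, ht⟩ := hK.elim_finite_subcover
        (fun U : {U : B // (Γ ω ∩ U.1).Nonempty} => N U.1) (fun _ => isOpen_interior) (by
          intro y hy
          obtain ⟨v, hv, hyv⟩ : ∃ v ∈ Γ ω, (y, v) ∉ C := by
            by_contra! hcon
            exact hω ⟨y, hcon, hy⟩
          obtain ⟨V, hV, W, hW, hVW⟩ := mem_nhds_prod_iff.1 (hC.isOpen_compl.mem_nhds hyv)
          obtain ⟨U, hU, hvU, hUW⟩ := hB.mem_nhds_iff.1 hW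
          refine mem_iUnion.2 ⟨⟨⟨U, hU⟩, v, hv, hvU⟩, mem_interior_iff_mem_nhds.2 ?_⟩
          filter_upwards [hV] with y' hy' v' hv'
          exact hVW (mk_mem_prod hy' (hUW hv')))
      classical
      refine ⟨t.image Subtype.val, by rwa [Finset.set_biUnion_finset_image], fun U hU => ?_⟩
      obtain ⟨U', -, rfl⟩ := Finset.mem_image.1 hU
      exact U'.2
    · rintro ⟨t, hKt, ht⟩ ⟨y, hy, hyK⟩
      obtain ⟨U, hU, hyU⟩ := mem_iUnion₂.1 (hKt hyK)
      obtain ⟨v, hv, hvU⟩ := ht U hU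
      exact interior_subset hyU v hvU (hy v hv)
  refine MeasurableSet.of_compl ?_
  rw [key]
  exact .iUnion fun t => .iUnion fun _ => Finset.measurableSet_biInter t fun U _ =>
    h _ (hB.isOpen U.2)

open BN in
/-- **Measurability of the quasi-sure support and its polar cone** (Lemma 4.3).
For a set-valued map `𝒫` with nonempty values and analytic graph and Borel
`X : Ω × Ω₁ → ℝ^d`, the quasi-sure support `Λ(ω)` of the laws of `X(ω, ·)` is
closed-valued and universally measurable, its polar cone `Λ°(ω)` is
nonempty-closed-valued and universally measurable, and `Λ°(ω)` consists exactly of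
those `y` with `y·X(ω,·) ≥ 0` `𝒫(ω)`-q.s. -/
theorem support_and_polar_cone_measurable
    (Ω : Type) [MeasurableSpace Ω] [TopologicalSpace Ω] [PolishSpace Ω] [BorelSpace Ω]
    (Ω₁ : Type) [MeasurableSpace Ω₁] [TopologicalSpace Ω₁] [PolishSpace Ω₁]
    [BorelSpace Ω₁] (d : ℕ)
    (PP : Ω → Set (ProbabilityMeasure Ω₁)) (hne : ∀ ω, (PP ω).Nonempty)
    (hgraph : AnalyticSet {p : Ω × ProbabilityMeasure Ω₁ | p.2 ∈ PP p.1})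
    (X : Ω × Ω₁ → Fin d → ℝ) (hX : Measurable X) :
    let Λ : Ω → Set (Fin d → ℝ) := fun ω =>
      qsSupp ((fun P : ProbabilityMeasure Ω₁ =>
        (P : Measure Ω₁).map (fun x => X (ω, x))) '' PP ω)
    let Λp : Ω → Set (Fin d → ℝ) := fun ω => {y | ∀ v ∈ Λ ω, 0 ≤ ∑ i, y i * v i}
    (∀ ω, IsClosed (Λ ω)) ∧
    (∀ A : Set (Fin d → ℝ), IsClosed A →
      MeasurableSet[univComp Ω] {ω | (Λ ω ∩ A).Nonempty}) ∧
    (∀ ω, (Λp ω).Nonempty ∧ IsClosed (Λp ω)) ∧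
    (∀ A : Set (Fin d → ℝ), IsClosed A →
      MeasurableSet[univComp Ω] {ω | (Λp ω ∩ A).Nonempty}) ∧
    (∀ ω, Λp ω = {y | QuasiSure
      ((fun P : ProbabilityMeasure Ω₁ => (P : Measure Ω₁)) '' PP ω)
      ‹MeasurableSpace Ω₁› (fun x => 0 ≤ ∑ i, y i * X (ω, x) i)}) := by
  intro Λ Λp
  have hXω : ∀ ω, Measurable fun x => X (ω, x) := fun ω => hX.comp measurable_prodMk_left
  have hinter : ∀ ω (O : Set (Fin d → ℝ)), IsOpen O → ((Λ ω ∩ O).Nonempty ↔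
      ∃ P ∈ PP ω, (P : Measure Ω₁) (Prod.mk ω ⁻¹' (X ⁻¹' O)) ≠ 0) := fun ω O hO => by
    have hprob : ∀ R ∈ (fun P : ProbabilityMeasure Ω₁ =>
        (P : Measure Ω₁).map (fun x => X (ω, x))) '' PP ω, IsProbabilityMeasure R := by
      rintro _ ⟨P, -, rfl⟩
      exact Measure.isProbabilityMeasure_map (hXω ω).aemeasurable
    rw [qsSupp_inter_nonempty_iff hprob hO, exists_mem_image]
    simp_rw [Measure.map_apply (hXω ω) hO.measurableSet]
    rfl
  have hopen : ∀ O : Set (Fin d → ℝ), IsOpen O →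
      MeasurableSet[univComp Ω] {ω | (Λ ω ∩ O).Nonempty} := fun O hO => by
    simp_rw [fun ω => hinter ω O hO]
    exact measurableSet_univComp_of_analyticSet
      (analyticSet_exists_measure_section_ne_zero hgraph (hX hO.measurableSet))
  have hclosed : ∀ ω, IsClosed (Λ ω) := fun ω => isClosed_qsSupp _
  refine ⟨hclosed, fun A hA => @measurableSet_inter_nonempty_of_isOpen _ _ (univComp Ω) _ _ _
    hclosed hopen _ hA, fun ω => ⟨⟨0, fun v _ => by simp⟩, ?_⟩, fun A hA => ?_, fun ω => ?_⟩
  · simp only [Λp, ofPred_forall]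
    exact isClosed_biInter fun v _ => isClosed_le continuous_const (by fun_prop)
  · exact @measurableSet_dual_inter_nonempty _ _ _ (univComp Ω) _ _ _ _ _ hopen
      {p : (Fin d → ℝ) × (Fin d → ℝ) | 0 ≤ ∑ i, p.1 i * p.2 i}
      (isClosed_le continuous_const (by fun_prop)) _ hA
  · ext y
    have hO : IsOpen {v : Fin d → ℝ | ∑ i, y i * v i < 0} :=
      isOpen_lt (by fun_prop) continuous_const
    have hiff : y ∈ Λp ω ↔ ¬ (Λ ω ∩ {v | ∑ i, y i * v i < 0}).Nonempty := by
      simp only [Λp, Set.Nonempty, mem_inter_iff, mem_ofPred_eq, not_exists, not_and, not_lt]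
    rw [hiff, hinter ω _ hO]
    push Not
    constructor
    · intro h
      refine ⟨_, hXω ω hO.measurableSet, fun x hx => not_le.1 hx, ?_⟩
      rintro _ ⟨P, hP, rfl⟩
      exact h P hP
    · rintro ⟨A, -, hsub, hA⟩ P hP
      exact measure_mono_null (fun x hx => hsub (not_le.2 hx)) (hA _ (mem_image_of_mem _ hP))
end
end

section
/- Polarity of the local no-arbitrage failure set (Lemma 4.6): Fix t ∈ {0,…,T−1} and let N_t := {ω ∈ Ω_t : NA(𝒫_t(ω)) fails}, where NA(𝒫_t(ω)) is the one-period no-arbitrage condition on (Ω₁, ℬ(Ω₁)) for the increment ΔS_{t+1}(ω,·) := S_{t+1}(ω,·) − S_t(ω) under the family 𝒫_t(ω). Then N_t is universally measurable, and if NA(𝒫) holds then N_t is 𝒫-polar. -/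
open MeasureTheory Set Filter Topology
open scoped ENNReal NNReal

noncomputable section

namespace BN

/-! ### Universal measurability of analytic sets -/

section Analytic

variable {α β : Type*}

/-- The sets of sequences dominated by `n` on initial segments lie, from some point on, in any
neighbourhood of the compact set of sequences dominated by `n` everywhere. -/
theorem exists_forall_lt_le_subset_of_isOpen (n : ℕ → ℕ) {U : Set (ℕ → ℕ)} (hU : IsOpen U)
    (hn : Iic n ⊆ U) :
    ∃ k, {x : ℕ → ℕ | ∀ i < k, x i ≤ n i} ⊆ U := by
  have hK : IsCompact (Iic n) := by
    rw [← Icc_bot]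
    exact isCompact_Icc
  have hcyl : ∀ x ∈ Iic n, ∃ k, PiNat.cylinder x k ⊆ U := by
    intro x hx
    obtain ⟨v, ⟨y, m, rfl⟩, hxv, hvU⟩ :=
      (PiNat.isTopologicalBasis_cylinders (fun _ => ℕ)).exists_subset_of_mem_open (hn hx) hU
    exact ⟨m, by rwa [← PiNat.mem_cylinder_iff_eq.1 hxv] at hvU⟩
  choose! k hk using hcyl
  obtain ⟨t, htK, ht⟩ := hK.elim_nhds_subcover (fun x => PiNat.cylinder x (k x))
    fun x _ => (PiNat.isOpen_cylinder _ x (k x)).mem_nhds (PiNat.self_mem_cylinder x (k x))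
  refine ⟨t.sup k, fun z hz => ?_⟩
  have hmin : (fun i => min (z i) (n i)) ∈ Iic n :=
    fun i => min_le_right _ _
  obtain ⟨x, hxt, hx⟩ := mem_iUnion₂.1 (ht hmin)
  refine hk x (htK x hxt) fun i hi => ?_
  rw [← hx i hi]
  exact (min_eq_left (hz i (hi.trans_le (Finset.le_sup hxt)))).symm

/-- A set which is analytic can be approximated in outer measure from inside by compact sets. -/
theorem _root_.MeasureTheory.AnalyticSet.exists_isCompact_subset_le [TopologicalSpace α] [T2Space α]
    [MeasurableSpace α] [OpensMeasurableSpace α] {s : Set α} (hs : AnalyticSet s)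
    (μ : Measure α) [IsFiniteMeasure μ] {c : ℝ≥0∞} (hc : c < μ s) :
    ∃ K ⊆ s, IsCompact K ∧ c ≤ μ K := by
  rw [AnalyticSet] at hs
  rcases hs with rfl | ⟨f, hf, rfl⟩
  · simp at hc
  have step : ∀ (k : ℕ) (D : {D : Set (ℕ → ℕ) // c < μ (f '' D)}),
      ∃ m : ℕ, c < μ (f '' (D.1 ∩ {x | x k ≤ m})) := by
    rintro k ⟨D, hD⟩
    have hmono : Monotone fun m : ℕ => f '' (D ∩ {x | x k ≤ m}) := fun a b hab =>
      image_mono (inter_subset_inter_right _ fun x (hx : x k ≤ a) => hx.trans hab)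
    have hun : f '' D = ⋃ m : ℕ, f '' (D ∩ {x | x k ≤ m}) := by
      rw [← image_iUnion, ← inter_iUnion]
      congr 1
      exact (inter_eq_left.2 fun x _ => mem_iUnion.2 ⟨x k, le_refl (x k)⟩).symm
    rw [hun, hmono.measure_iUnion] at hD
    exact lt_iSup_iff.1 hD
  choose m hm using step
  let D : ℕ → {D : Set (ℕ → ℕ) // c < μ (f '' D)} := fun k =>
    Nat.rec ⟨univ, by rwa [image_univ]⟩ (fun k D => ⟨D.1 ∩ {x | x k ≤ m k D}, hm k D⟩) k
  let n : ℕ → ℕ := fun k => m k (D k)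
  have hD : ∀ k, (D k).1 = {x | ∀ i < k, x i ≤ n i} := by
    intro k
    induction k with
    | zero => ext x; simp [D]
    | succ k ih =>
      ext x
      change x ∈ (D k).1 ∩ {x | x k ≤ n k} ↔ _
      rw [ih]
      simp only [mem_inter_iff, mem_ofPred_eq, Nat.forall_lt_succ_right]
  have hK : IsCompact (Iic n) := by
    rw [← Icc_bot]
    exact isCompact_Icc
  refine ⟨f '' Iic n, image_subset_range _ _, hK.image hf, ?_⟩
  have hsub : ⋂ k, closure (f '' (D k).1) ⊆ f '' Iic n := by
    intro y hy
    by_contra hyK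
    obtain ⟨U, V, hU, hV, hKU, hyV, hUV⟩ :=
      SeparatedNhds.of_isCompact_isCompact (hK.image hf) (isCompact_singleton (x := y))
        (disjoint_singleton_right.2 hyK)
    obtain ⟨k, hk⟩ := exists_forall_lt_le_subset_of_isOpen n (hU.preimage hf)
      (image_subset_iff.1 hKU)
    rw [← hD k] at hk
    obtain ⟨z, hzV, hz⟩ := mem_closure_iff.1 (mem_iInter.1 hy k) V hV (hyV rfl)
    exact hUV.le_bot ⟨image_subset_iff.2 hk hz, hzV⟩
  have hanti : Antitone fun k => closure (f '' (D k).1) := by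
    refine antitone_nat_of_succ_le fun k => closure_mono (image_mono ?_)
    rw [hD k, hD (k + 1)]
    exact fun x hx i hi => hx i (hi.trans (Nat.lt_succ_self k))
  calc c ≤ ⨅ k, μ (closure (f '' (D k).1)) :=
        le_iInf fun k => (D k).2.le.trans (measure_mono subset_closure)
    _ = μ (⋂ k, closure (f '' (D k).1)) :=
        (hanti.measure_iInter (fun k => isClosed_closure.measurableSet.nullMeasurableSet)
          ⟨0, measure_ne_top _ _⟩).symm
    _ ≤ _ := measure_mono hsub

theorem _root_.MeasureTheory.AnalyticSet.nullMeasurableSet [TopologicalSpace α] [T2Space α]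
    [MeasurableSpace α]
    [OpensMeasurableSpace α] {s : Set α} (hs : AnalyticSet s) (μ : Measure α)
    [IsFiniteMeasure μ] : NullMeasurableSet s μ := by
  rcases eq_or_ne (μ s) 0 with h0 | h0
  · exact NullMeasurableSet.of_null h0
  obtain ⟨c, -, hc, hclim⟩ := exists_seq_strictMono_tendsto' (pos_iff_ne_zero.2 h0)
  choose K hKs hK hcK using fun j => hs.exists_isCompact_subset_le μ (hc j).2
  have hM : MeasurableSet (⋃ j, K j) := .iUnion fun j => (hK j).isClosed.measurableSet
  have hle : μ s ≤ μ (⋃ j, K j) :=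
    le_of_tendsto' hclim fun j => (hcK j).trans (measure_mono (subset_iUnion K j))
  exact hM.nullMeasurableSet.congr (ae_eq_of_subset_of_measure_ge (iUnion_subset hKs) hle
    hM.nullMeasurableSet (measure_ne_top _ _))

theorem _root_.MeasureTheory.AnalyticSet.measurableSet_univComp [TopologicalSpace α]
    [T2Space α] [MeasurableSpace α]
    [OpensMeasurableSpace α] {s : Set α} (hs : AnalyticSet s) :
    MeasurableSet[univComp α] s :=
  fun μ _ => hs.nullMeasurableSet μ

end Analytic

/-! ### Universally measurable functions -/

section UnivComp

variable {α β : Type*} [MeasurableSpace α] [MeasurableSpace β]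

theorem le_univComp : ‹MeasurableSpace α› ≤ univComp α :=
  fun _ hs _ _ => hs.nullMeasurableSet

theorem nullMeasurable_of_univComp {f : α → β} (hf : Measurable[univComp α] f) (μ : Measure α)
    [hμ : IsProbabilityMeasure μ] : NullMeasurable f μ :=
  fun _ hs => hf hs μ hμ

/-- A universally measurable function pulls back universally measurable sets to universally
measurable sets. -/
theorem measurable_univComp_univComp [MeasurableSpace.CountablyGenerated β] {f : α → β}
    (hf : Measurable[univComp α] f) : Measurable[univComp α, univComp β] f := by
  intro s hs μ hμ
  have hfμ : AEMeasurable f μ := (nullMeasurable_of_univComp hf μ).aemeasurable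
  have : IsProbabilityMeasure (μ.map f) := Measure.isProbabilityMeasure_map hfμ
  exact (hs (μ.map f) this).preimage ⟨hfμ.measurable_mk, by
    rw [← Measure.map_congr hfμ.ae_eq_mk]⟩ |>.congr (hfμ.ae_eq_mk.symm.preimage s)

end UnivComp

/-! ### Measurable uniformization of analytic sets -/

section Uniformization

variable {X Y : Type*}

/-- The least possible next term of a sequence extending `l` which is mapped to `x`. -/
def nextTerm (p : (ℕ → ℕ) → X) (x : X) (l : List ℕ) : ℕ :=
  sInf {n | x ∈ p '' {z | PiNat.res z (l.length + 1) = n :: l}}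

/-- The initial segments of the lexicographically least sequence mapped to `x`. -/
def leastPrefix (p : (ℕ → ℕ) → X) (x : X) : ℕ → List ℕ
  | 0 => []
  | k + 1 => nextTerm p x (leastPrefix p x k) :: leastPrefix p x k

/-- The lexicographically least sequence mapped to `x`. -/
def leastBranch (p : (ℕ → ℕ) → X) (x : X) (k : ℕ) : ℕ :=
  nextTerm p x (leastPrefix p x k)

theorem res_leastBranch (p : (ℕ → ℕ) → X) (x : X) (k : ℕ) :
    PiNat.res (leastBranch p x) k = leastPrefix p x k := by
  induction k with
  | zero => rfl
  | succ k ih => rw [PiNat.res_succ, ih]; rfl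

theorem apply_leastBranch [TopologicalSpace X] [T1Space X] {p : (ℕ → ℕ) → X} (hp : Continuous p)
    {x : X} (hx : x ∈ range p) : p (leastBranch p x) = x := by
  have hpre : ∀ k, ∃ z, PiNat.res z k = leastPrefix p x k ∧ p z = x := by
    intro k
    induction k with
    | zero => obtain ⟨z, hz⟩ := hx; exact ⟨z, rfl, hz⟩
    | succ k ih =>
      obtain ⟨z, hz, hzx⟩ := ih
      have hlen : (leastPrefix p x k).length = k := by rw [← hz, PiNat.res_length]
      have hmem := Nat.sInf_mem (s := {n | x ∈ p '' {z | PiNat.res z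
        ((leastPrefix p x k).length + 1) = n :: leastPrefix p x k}})
        ⟨z k, z, by simp [hlen, hz], hzx⟩
      obtain ⟨w, hw, hwx⟩ := hmem
      refine ⟨w, ?_, hwx⟩
      rw [mem_ofPred_eq] at hw
      conv_lhs at hw => rw [hlen]
      exact hw
  have hclosed : IsClosed (p ⁻¹' {x}) := isClosed_singleton.preimage hp
  change leastBranch p x ∈ p ⁻¹' {x}
  rw [← hclosed.closure_eq, (PiNat.isTopologicalBasis_cylinders (fun _ => ℕ)).mem_closure_iff]
  rintro _ ⟨y, m, rfl⟩ hy
  obtain ⟨z, hz, hzx⟩ := hpre m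
  refine ⟨z, ?_, hzx⟩
  rw [← PiNat.mem_cylinder_iff_eq.1 hy, PiNat.cylinder_eq_res]
  rw [mem_ofPred_eq, hz, res_leastBranch]

theorem measurable_sInf_nat [MeasurableSpace X] {A : ℕ → Set X} (hA : ∀ n, MeasurableSet (A n)) :
    Measurable fun x => sInf {n | x ∈ A n} := by
  refine measurable_of_Iic fun n => ?_
  have : (fun x => sInf {n | x ∈ A n}) ⁻¹' Iic n =
      (⋃ m, ⋃ _ : m ≤ n, A m) ∪ ⋂ m, (A m)ᶜ := by
    ext x
    simp only [mem_preimage, mem_Iic, mem_union, mem_iUnion, mem_iInter, mem_compl_iff,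
      exists_prop]
    constructor
    · intro h
      by_cases hne : {n | x ∈ A n}.Nonempty
      · exact .inl ⟨_, h, Nat.sInf_mem hne⟩
      · exact .inr fun m hm => hne ⟨m, hm⟩
    · rintro (⟨m, hm, hx⟩ | h)
      · exact (Nat.sInf_le hx).trans hm
      · rw [show {n | x ∈ A n} = ∅ from eq_empty_of_forall_notMem h, Nat.sInf_empty]
        exact Nat.zero_le n
  rw [this]
  exact (MeasurableSet.iUnion fun m => .iUnion fun _ => hA m).union
    (.iInter fun m => (hA m).compl)

theorem measurable_leastBranch [TopologicalSpace X] [T2Space X] [MeasurableSpace X]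
    [OpensMeasurableSpace X] {p : (ℕ → ℕ) → X} (hp : Continuous p) :
    Measurable[univComp X] (leastBranch p) := by
  have hopen : ∀ k (l : List ℕ), IsOpen {z : ℕ → ℕ | PiNat.res z k = l} := by
    intro k l
    refine isOpen_iff_mem_nhds.2 fun z hz => ?_
    filter_upwards [(PiNat.isOpen_cylinder _ z k).mem_nhds (PiNat.self_mem_cylinder z k)]
      with w hw
    rw [PiNat.cylinder_eq_res] at hw
    exact hw.trans hz
  have hnext : ∀ l, Measurable[univComp X] fun x => nextTerm p x l := fun l =>
    @measurable_sInf_nat _ (univComp X) _ fun n =>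
      ((hopen (l.length + 1) (n :: l)).analyticSet_image hp).measurableSet_univComp
  generalize univComp X = m at hnext ⊢
  let : MeasurableSpace (List ℕ) := ⊤
  have hpre : ∀ k, Measurable[m] fun x => leastPrefix p x k := by
    intro k
    induction k with
    | zero => exact measurable_const
    | succ k ih =>
      refine measurable_to_countable' fun l => ?_
      have : (fun x => leastPrefix p x (k + 1)) ⁻¹' {l} =
          ⋃ l' : List ℕ, (fun x => leastPrefix p x k) ⁻¹' {l'} ∩
            (fun x => nextTerm p x l') ⁻¹' {n | n :: l' = l} := by
        ext x
        simp [leastPrefix]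
      rw [this]
      exact .iUnion fun l' => (ih (.of_discrete)).inter (hnext l' .of_discrete)
  refine measurable_pi_iff.2 fun k => measurable_to_countable' fun n => ?_
  have : (fun x => leastBranch p x k) ⁻¹' {n} =
      ⋃ l' : List ℕ, (fun x => leastPrefix p x k) ⁻¹' {l'} ∩
        (fun x => nextTerm p x l') ⁻¹' {n} := by
    ext x
    simp [leastBranch]
  rw [this]
  exact .iUnion fun l' => (hpre k .of_discrete).inter (hnext l' .of_discrete)

/-- **Jankov–von Neumann uniformization**: an analytic subset of a product has a universally
measurable selector on its projection. -/
theorem _root_.MeasureTheory.AnalyticSet.exists_measurable_selector [TopologicalSpace X] [T2Space X]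
    [MeasurableSpace X] [OpensMeasurableSpace X] [TopologicalSpace Y] [Nonempty Y]
    {G : Set (X × Y)} (hG : AnalyticSet G) :
    ∃ σ : X → Y, Measurable[univComp X, borel Y] σ ∧ ∀ x ∈ Prod.fst '' G, (x, σ x) ∈ G := by
  rw [AnalyticSet] at hG
  rcases hG with rfl | ⟨f, hf, rfl⟩
  · exact ⟨fun _ => Classical.arbitrary Y, @measurable_const _ _ (borel Y) (univComp X) _,
      by simp⟩
  have hp : Continuous fun z => (f z).1 := continuous_fst.comp hf
  have hsnd : Measurable[_, borel Y] fun z => (f z).2 := by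
    let : MeasurableSpace Y := borel Y
    have : BorelSpace Y := ⟨rfl⟩
    exact (continuous_snd.comp hf).measurable
  refine ⟨(fun z => (f z).2) ∘ leastBranch fun z => (f z).1,
    @Measurable.comp _ _ _ (univComp X) _ (borel Y) _ _ hsnd (measurable_leastBranch hp), ?_⟩
  rintro x ⟨_, ⟨z, rfl⟩, rfl⟩
  exact ⟨leastBranch (fun z => (f z).1) (f z).1,
    Prod.ext (apply_leastBranch hp (mem_range_self z)) rfl⟩

theorem exists_measurable_selector_of_nonempty [TopologicalSpace X] [T2Space X]
    [MeasurableSpace X] [OpensMeasurableSpace X] [TopologicalSpace Y] {F : X → Set Y}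
    (hF : AnalyticSet {p : X × Y | p.2 ∈ F p.1}) (hne : ∀ x, (F x).Nonempty) :
    ∃ σ : X → Y, Measurable[univComp X, borel Y] σ ∧ ∀ x, σ x ∈ F x := by
  cases isEmpty_or_nonempty X with
  | inl h => exact ⟨h.elim, @measurable_of_empty _ _ (univComp X) (borel Y) _ _, h.elim⟩
  | inr h =>
    have : Nonempty Y := (hne h.some).to_type
    obtain ⟨σ, hσ, hσF⟩ := hF.exists_measurable_selector
    exact ⟨σ, hσ, fun x => hσF x ⟨(x, (hne x).some), (hne x).some_mem, rfl⟩⟩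

end Uniformization

/-! ### Measurability of families of probability measures -/

section ProbabilityMeasure

variable {Ω : Type*} [MeasurableSpace Ω]

theorem giry_le_borel [TopologicalSpace Ω] [HasOuterApproxClosed Ω] [BorelSpace Ω] :
    (inferInstance : MeasurableSpace (ProbabilityMeasure Ω)) ≤ borel (ProbabilityMeasure Ω) := by
  suffices h : Measurable[borel (ProbabilityMeasure Ω)]
      (fun P : ProbabilityMeasure Ω => (P : Measure Ω)) from h.comap_le
  let : MeasurableSpace (ProbabilityMeasure Ω) := borel (ProbabilityMeasure Ω)
  have : BorelSpace (ProbabilityMeasure Ω) := ⟨rfl⟩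
  refine Measurable.measure_of_isPiSystem_of_isProbabilityMeasure
    (S := {s : Set Ω | IsClosed s}) ?_ isPiSystem_isClosed fun s hs => ?_
  · rw [BorelSpace.measurable_eq (α := Ω), borel_eq_generateFrom_isClosed]
  · have hs : IsClosed s := hs
    refine measurable_of_tendsto_metrizable
      (f := fun n (P : ProbabilityMeasure Ω) => ∫⁻ x, hs.apprSeq n x ∂(P : Measure Ω))
      (fun n => ?_) (tendsto_pi_nhds.2 fun P =>
        HasOuterApproxClosed.tendsto_lintegral_apprSeq hs (P : Measure Ω))
    exact (ProbabilityMeasure.continuous_lintegral_boundedContinuousFunction _).measurable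

instance countablyGenerated_probabilityMeasure [MeasurableSpace.CountablyGenerated Ω] :
    MeasurableSpace.CountablyGenerated (ProbabilityMeasure Ω) := by
  obtain ⟨b, hb, hgen⟩ := MeasurableSpace.CountablyGenerated.isCountablyGenerated (α := Ω)
  have hc : (generateSetAlgebra b).Countable := countable_generateSetAlgebra hb
  have hgen' : ‹MeasurableSpace Ω› = .generateFrom (generateSetAlgebra b) := by
    rw [generateFrom_generateSetAlgebra_eq, hgen]
  have : Countable (generateSetAlgebra b) := hc
  let e : ProbabilityMeasure Ω → generateSetAlgebra b → ℝ≥0∞ := fun P s => (P : Measure Ω) s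
  have he : Subtype.instMeasurableSpace = MeasurableSpace.comap e inferInstance := by
    apply le_antisymm
    · have h : Measurable[MeasurableSpace.comap e inferInstance]
          (fun P : ProbabilityMeasure Ω => (P : Measure Ω)) := by
        let : MeasurableSpace (ProbabilityMeasure Ω) := MeasurableSpace.comap e inferInstance
        refine Measurable.measure_of_isPiSystem_of_isProbabilityMeasure hgen'
          (fun s hs t ht _ => isSetAlgebra_generateSetAlgebra.inter_mem hs ht) fun s hs => ?_
        exact (measurable_pi_apply (⟨s, hs⟩ : generateSetAlgebra b)).comp
          (comap_measurable e)
      exact h.comap_le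
    · refine Measurable.comap_le (measurable_pi_iff.2 fun s => ?_)
      refine (Measure.measurable_coe ?_).comp measurable_subtype_coe
      rw [hgen']
      exact MeasurableSpace.measurableSet_generateFrom s.2
  have h := MeasurableSpace.CountablyGenerated.comap (m := inferInstance) e
  rw [← he] at h
  exact h

/-- A measurable family of probability measures as a kernel. -/
def kernelOf {X : Type*} [MeasurableSpace X] (κ : X → ProbabilityMeasure Ω) (hκ : Measurable κ) :
    ProbabilityTheory.Kernel X Ω :=
  ⟨fun x => κ x, measurable_subtype_coe.comp hκ⟩

instance {X : Type*} [MeasurableSpace X] (κ : X → ProbabilityMeasure Ω) (hκ : Measurable κ) :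
    ProbabilityTheory.IsMarkovKernel (kernelOf κ hκ) :=
  ⟨fun x => (κ x).2⟩

/-- The part of an analytic set of pairs `(ω, P)` on which `P` charges the section at `ω` of a
given measurable set is analytic. -/
theorem analyticSet_charge [TopologicalSpace Ω] [HasOuterApproxClosed Ω] [BorelSpace Ω]
    {X : Type*} [TopologicalSpace X] [MeasurableSpace X] [BorelSpace X]
    {G : Set (X × ProbabilityMeasure Ω)} (hG : AnalyticSet G) {B : Set (X × Ω)}
    (hB : MeasurableSet B) :
    AnalyticSet {p | p ∈ G ∧ (p.2 : Measure Ω) {x | (p.1, x) ∈ B} ≠ 0} := by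
  rw [AnalyticSet] at hG
  rcases hG with rfl | ⟨f, hf, rfl⟩
  · simpa using! analyticSet_empty
  have h1 : Measurable fun z => (f z).1 := (continuous_fst.comp hf).measurable
  have h2 : Measurable fun z => (f z).2 := by
    have : Measurable[_, borel _] fun z => (f z).2 := by
      let : MeasurableSpace (ProbabilityMeasure Ω) := borel (ProbabilityMeasure Ω)
      have : BorelSpace (ProbabilityMeasure Ω) := ⟨rfl⟩
      exact (continuous_snd.comp hf).measurable
    exact this.mono le_rfl giry_le_borel
  have hB' : MeasurableSet {q : (ℕ → ℕ) × Ω | ((f q.1).1, q.2) ∈ B} :=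
    ((h1.comp measurable_fst).prodMk measurable_snd) hB
  have hm := ProbabilityTheory.Kernel.measurable_kernel_prodMk_left (κ := kernelOf _ h2) hB'
  have hset : MeasurableSet {z | ((f z).2 : Measure Ω) {x | ((f z).1, x) ∈ B} ≠ 0} :=
    (hm (measurableSet_singleton 0)).compl
  convert hset.analyticSet.image_of_continuous hf using 1
  ext p
  constructor
  · rintro ⟨⟨z, rfl⟩, hz⟩
    exact ⟨z, hz, rfl⟩
  · rintro ⟨z, hz, rfl⟩
    exact ⟨mem_range_self z, hz⟩

end ProbabilityMeasure

/-! ### One-period arbitrage strategies depending on a parameter -/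

section Arbitrage

/-- `y` is an arbitrage strategy for the increment `Δ` under the family `PP`. -/
def IsArbitrage {Ω : Type*} [MeasurableSpace Ω] {d : ℕ} (PP : Set (ProbabilityMeasure Ω))
    (Δ : Ω → Fin d → ℝ) (y : Fin d → ℝ) : Prop :=
  (∀ P ∈ PP, (P : Measure Ω) {x | ∑ i, y i * Δ x i < 0} = 0) ∧
    ∃ P ∈ PP, (P : Measure Ω) {x | 0 < ∑ i, y i * Δ x i} ≠ 0

theorem quasiSure_iff {α : Type*} {m : MeasurableSpace α} [MeasurableSpace α]
    {PP : Set (Measure α)} {p : α → Prop} (hp : MeasurableSet[m] {x | ¬ p x}) :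
    QuasiSure PP m p ↔ ∀ P ∈ PP, ∀ᵐ x ∂P, p x := by
  constructor
  · rintro ⟨A, -, hA, hA0⟩ P hP
    exact measure_mono_null hA (hA0 P hP)
  · exact fun h => ⟨_, hp, subset_rfl, h⟩

theorem not_NA1_iff {Ω : Type*} [MeasurableSpace Ω] {d : ℕ} {PP : Set (ProbabilityMeasure Ω)}
    {Δ : Ω → Fin d → ℝ} (hΔ : Measurable Δ) :
    ¬ NA1 ((fun P : ProbabilityMeasure Ω => (P : Measure Ω)) '' PP) Δ ↔
      ∃ y, IsArbitrage PP Δ y := by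
  have hsum : ∀ y : Fin d → ℝ, Measurable fun x => ∑ i, y i * Δ x i := fun y =>
    Finset.measurable_sum _ fun i _ => ((measurable_pi_apply i).comp hΔ).const_mul (y i)
  unfold NA1
  push Not
  refine exists_congr fun y => ?_
  rw [quasiSure_iff (p := fun x => 0 ≤ ∑ i, y i * Δ x i)
      (measurableSet_le measurable_const (hsum y)).compl,
    quasiSure_iff (p := fun x => ∑ i, y i * Δ x i = 0)
      ((hsum y) (measurableSet_singleton 0)).compl]
  simp only [forall_mem_image, not_forall, exists_prop, IsArbitrage, ae_iff, not_le]
  refine and_congr_right fun h => exists_congr fun P => and_congr_right fun hP => not_congr ?_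
  constructor
  · exact measure_mono_null fun x hx => ne_of_gt hx
  · intro h0
    refine measure_mono_null (fun x hx => ?_) (measure_union_null (h hP) h0)
    exact lt_or_gt_of_ne hx

variable {d : ℕ}

/-- The strategies whose gain is negative and bounded away from zero for increments in `O`. -/
def strictlyLosing (O : Set (Fin d → ℝ)) : Set (Fin d → ℝ) :=
  {y | ∃ k : ℕ, ∀ v ∈ O, ∑ i, y i * v i ≤ -(1 / ((k : ℝ) + 1))}

theorem measurableSet_strictlyLosing (O : Set (Fin d → ℝ)) :
    MeasurableSet (strictlyLosing O) := by
  have : strictlyLosing O = ⋃ k : ℕ, ⋂ v ∈ O, {y | ∑ i, y i * v i ≤ -(1 / ((k : ℝ) + 1))} := by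
    ext y
    simp [strictlyLosing]
  rw [this]
  refine .iUnion fun k => IsClosed.measurableSet ?_
  exact isClosed_biInter fun v _ => isClosed_le (by fun_prop) continuous_const

theorem exists_charge_neg_iff {Ω : Type*} [MeasurableSpace Ω] {PP : Set (ProbabilityMeasure Ω)}
    {Δ : Ω → Fin d → ℝ} (y : Fin d → ℝ) :
    (∃ P ∈ PP, (P : Measure Ω) {x | ∑ i, y i * Δ x i < 0} ≠ 0) ↔
      ∃ O : TopologicalSpace.countableBasis (Fin d → ℝ),
        (∃ P ∈ PP, (P : Measure Ω) {x | Δ x ∈ O.1} ≠ 0) ∧ y ∈ strictlyLosing O.1 := by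
  constructor
  · rintro ⟨P, hP, hne⟩
    by_contra! hcon
    refine hne (measure_mono_null (t := ⋃ O : {O : TopologicalSpace.countableBasis (Fin d → ℝ) //
      y ∈ strictlyLosing O.1}, {x | Δ x ∈ O.1.1}) (fun x hx => ?_) ?_)
    · have hx : ∑ i, y i * Δ x i < 0 := hx
      obtain ⟨k, hk⟩ := exists_nat_one_div_lt (neg_pos.2 hx)
      have hopen : IsOpen {v : Fin d → ℝ | ∑ i, y i * v i < -(1 / ((k : ℝ) + 1))} :=
        isOpen_lt (by fun_prop) continuous_const
      obtain ⟨O, hO, hxO, hsub⟩ := (TopologicalSpace.isBasis_countableBasis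
        (Fin d → ℝ)).exists_subset_of_mem_open
        (show Δ x ∈ {v : Fin d → ℝ | ∑ i, y i * v i < -(1 / ((k : ℝ) + 1))} from
          lt_neg_of_lt_neg hk) hopen
      exact mem_iUnion.2 ⟨⟨⟨O, hO⟩, k, fun v hv => (hsub hv).le⟩, hxO⟩
    · refine measure_iUnion_null fun O => ?_
      by_contra hO
      exact hcon O.1 ⟨P, hP, hO⟩ O.2
  · rintro ⟨O, ⟨P, hP, hne⟩, k, hk⟩
    refine ⟨P, hP, fun h0 => hne (measure_mono_null (fun x hx => ?_) h0)⟩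
    exact (hk _ hx).trans_lt (neg_neg_of_pos Nat.one_div_pos_of_nat)

variable {X Ω : Type*} [TopologicalSpace X] [T2Space X] [MeasurableSpace X] [BorelSpace X]
  [TopologicalSpace Ω] [HasOuterApproxClosed Ω] [MeasurableSpace Ω] [BorelSpace Ω]

/-- The parameters with an arbitrage strategy form a universally measurable set, on which
an arbitrage strategy can be chosen in a universally measurable way. -/
theorem exists_measurable_arbitrage {PP : X → Set (ProbabilityMeasure Ω)}
    (hPP : AnalyticSet {p : X × ProbabilityMeasure Ω | p.2 ∈ PP p.1})
    {Δ : X → Ω → Fin d → ℝ} (hΔ : Measurable fun q : X × Ω => Δ q.1 q.2) :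
    MeasurableSet[univComp X] {ω | ∃ y, IsArbitrage (PP ω) (Δ ω) y} ∧
      ∃ Y : X → Fin d → ℝ, Measurable[univComp X] Y ∧
        ∀ ω, (∃ y, IsArbitrage (PP ω) (Δ ω) y) → IsArbitrage (PP ω) (Δ ω) (Y ω) := by
  classical
  let ι : Type := TopologicalSpace.countableBasis (Fin d → ℝ)
  have : Countable ι := TopologicalSpace.countable_countableBasis (Fin d → ℝ)
  have : PolishSpace ((ι → Bool) × (Fin d → ℝ)) := .mk
  let E : ι → Set X := fun O => {ω | ∃ P ∈ PP ω, (P : Measure Ω) {x | Δ ω x ∈ O.1} ≠ 0}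
  have hE : ∀ O, MeasurableSet[univComp X] (E O) := by
    intro O
    have hO : MeasurableSet O.1 :=
      (TopologicalSpace.isOpen_of_mem_countableBasis O.2).measurableSet
    have h := (analyticSet_charge hPP (hΔ hO)).image_of_continuous continuous_fst
    convert h.measurableSet_univComp using 1
    ext ω
    constructor
    · rintro ⟨P, hP, hne⟩
      exact ⟨(ω, P), ⟨hP, hne⟩, rfl⟩
    · rintro ⟨⟨_, P⟩, ⟨hP, hne⟩, rfl⟩
      exact ⟨P, hP, hne⟩
  let J : X → ι → Bool := fun ω O => decide (ω ∈ E O)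
  have hJ : Measurable[univComp X] J := by
    refine @measurable_pi_lambda _ _ _ (univComp X) _ _ fun O => ?_
    refine @measurable_to_bool _ (univComp X) _ ?_
    convert hE O using 1
    ext ω
    simp [J]
  have hJ' := measurable_univComp_univComp hJ
  let W : Set ((ι → Bool) × (Fin d → ℝ)) :=
    {q | (∀ O, q.1 O = true → q.2 ∉ strictlyLosing O.1) ∧
      ∃ O, q.1 O = true ∧ -q.2 ∈ strictlyLosing O.1}
  have hW : MeasurableSet W := by
    let A : ι → Set ((ι → Bool) × (Fin d → ℝ)) := fun O => {q | q.1 O = true}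
    have hA : ∀ O : ι, MeasurableSet (A O) := fun O =>
      measurableSet_eq_fun ((measurable_pi_apply O).comp measurable_fst) measurable_const
    have hWeq : W = (⋂ O : ι, (A O ∩ Prod.snd ⁻¹' strictlyLosing O.1)ᶜ) ∩
        ⋃ O : ι, A O ∩ (fun q => -q.2) ⁻¹' strictlyLosing O.1 := by
      ext q
      simp [W, A]
    rw [hWeq]
    exact (MeasurableSet.iInter fun O => ((hA O).inter
      (measurable_snd (measurableSet_strictlyLosing O.1))).compl).inter (.iUnion fun O =>
        (hA O).inter (measurable_snd.neg (measurableSet_strictlyLosing O.1)))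
  have hWiff : ∀ ω y, IsArbitrage (PP ω) (Δ ω) y ↔ (J ω, y) ∈ W := by
    intro ω y
    refine and_congr ?_ ?_
    · have := not_congr (exists_charge_neg_iff (PP := PP ω) (Δ := Δ ω) y)
      push Not at this
      rw [this]
      simp only [J, E, decide_eq_true_eq, mem_ofPred_eq]
      exact forall_congr' fun O => ⟨by
        rintro h ⟨P, hP, hne⟩
        exact h ⟨P, hP, hne⟩, by
        rintro h ⟨P, hP, hne⟩
        exact h ⟨P, hP, hne⟩⟩
    · have := exists_charge_neg_iff (PP := PP ω) (Δ := Δ ω) (-y)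
      simp only [Pi.neg_apply, neg_mul, Finset.sum_neg_distrib, neg_lt_zero] at this
      rw [this]
      simp only [J, E, decide_eq_true_eq, mem_ofPred_eq]
      rfl
  obtain ⟨s, hs, hsW⟩ := hW.analyticSet.exists_measurable_selector
  rw [← BorelSpace.measurable_eq] at hs
  have hN : {ω | ∃ y, IsArbitrage (PP ω) (Δ ω) y} = J ⁻¹' (Prod.fst '' W) := by
    ext ω
    simp [hWiff]
  refine ⟨?_, fun ω => s (J ω), ?_, fun ω hω => ?_⟩
  · rw [hN]
    exact hJ' (hW.analyticSet.image_of_continuous continuous_fst).measurableSet_univComp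
  · exact @Measurable.comp _ _ _ (univComp X) (univComp (ι → Bool)) _ _ _ hs hJ'
  · rw [hWiff]
    exact hsW _ (hN.subset hω)

end Arbitrage

/-! ### Product measures built from universally measurable kernels -/

section Extension

variable {Ω₁ : Type}

theorem restr_snoc {t : ℕ} (ω : Fin t → Ω₁) (x : Ω₁) :
    restr Ω₁ t t.le_succ (Fin.snoc ω x : Fin (t + 1) → Ω₁) = ω := by
  funext i
  exact Fin.snoc_castSucc (α := fun _ => Ω₁) x ω i

variable [MeasurableSpace Ω₁]

theorem measurable_restr {T t : ℕ} (h : t ≤ T) : Measurable (restr Ω₁ t h) :=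
  measurable_pi_iff.2 fun i => measurable_pi_apply (Fin.castLE h i)

theorem measurable_snoc {t : ℕ} :
    Measurable fun q : (Fin t → Ω₁) × Ω₁ => (Fin.snoc q.1 q.2 : Fin (t + 1) → Ω₁) := by
  refine measurable_pi_iff.2 fun i => ?_
  induction i using Fin.lastCases with
  | last => simpa using measurable_snd
  | cast i => simpa using! (measurable_pi_apply i).comp measurable_fst

/-- The measure `ν ⊗ κ` on paths of length `t + 1`. -/
def extend {t : ℕ} (ν : Measure (Fin t → Ω₁)) (κ : (Fin t → Ω₁) → ProbabilityMeasure Ω₁) :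
    Measure (Fin (t + 1) → Ω₁) :=
  ν.bind fun ω => Measure.map (Fin.snoc ω) (κ ω : Measure Ω₁)

theorem extend_eq_map {t : ℕ} (ν : Measure (Fin t → Ω₁)) [SFinite ν]
    {κ : (Fin t → Ω₁) → ProbabilityMeasure Ω₁} (hκ : Measurable κ) :
    extend ν κ =
      (ν.compProd (kernelOf κ hκ)).map fun q => Fin.snoc q.1 q.2 := by
  have hmap : ∀ ω (s : Set (Fin (t + 1) → Ω₁)), MeasurableSet s →
      Measure.map (Fin.snoc (α := fun _ => Ω₁) ω) (κ ω : Measure Ω₁) s =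
        kernelOf κ hκ ω (Prod.mk ω ⁻¹' ((fun q => Fin.snoc q.1 q.2) ⁻¹' s)) := fun ω s hs =>
    Measure.map_apply (measurable_snoc.comp measurable_prodMk_left) hs
  have hmeas : Measurable fun ω =>
      Measure.map (Fin.snoc (α := fun _ => Ω₁) ω) (κ ω : Measure Ω₁) := by
    refine Measure.measurable_of_measurable_coe _ fun s hs => ?_
    simp only [hmap _ s hs]
    exact ProbabilityTheory.Kernel.measurable_kernel_prodMk_left (measurable_snoc hs)
  ext s hs
  rw [extend, Measure.bind_apply hs hmeas.aemeasurable, Measure.map_apply measurable_snoc hs,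
    Measure.compProd_apply (measurable_snoc hs)]
  exact lintegral_congr fun ω => hmap ω s hs

variable [TopologicalSpace Ω₁] [PolishSpace Ω₁] [BorelSpace Ω₁] {t : ℕ}
  {ν : Measure (Fin t → Ω₁)} [IsProbabilityMeasure ν] {κ : (Fin t → Ω₁) → ProbabilityMeasure Ω₁}

theorem exists_extend_eq_map
    (hκ : Measurable[univComp (Fin t → Ω₁), borel (ProbabilityMeasure Ω₁)] κ) :
    ∃ (κ' : (Fin t → Ω₁) → ProbabilityMeasure Ω₁) (hκ' : Measurable κ'), κ =ᵐ[ν] κ' ∧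
      extend ν κ =
        (ν.compProd (kernelOf κ' hκ')).map fun q => Fin.snoc q.1 q.2 := by
  obtain ⟨κ', hκ', he⟩ :=
    (nullMeasurable_of_univComp (hκ.mono le_rfl giry_le_borel) ν).aemeasurable
  refine ⟨κ', hκ', he, ?_⟩
  rw [← extend_eq_map]
  refine Measure.bind_congr_right ?_
  filter_upwards [he] with ω hω
  rw [hω]

theorem isProbabilityMeasure_extend
    (hκ : Measurable[univComp (Fin t → Ω₁), borel (ProbabilityMeasure Ω₁)] κ) :
    IsProbabilityMeasure
      (extend ν κ) := by
  obtain ⟨κ', hκ', -, he⟩ := exists_extend_eq_map (ν := ν) hκ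
  rw [he]
  exact Measure.isProbabilityMeasure_map measurable_snoc.aemeasurable

theorem map_restr_extend
    (hκ : Measurable[univComp (Fin t → Ω₁), borel (ProbabilityMeasure Ω₁)] κ) :
    (extend ν κ).map
      (restr Ω₁ t t.le_succ) = ν := by
  obtain ⟨κ', hκ', -, he⟩ := exists_extend_eq_map (ν := ν) hκ
  rw [he, Measure.map_map (measurable_restr _) measurable_snoc]
  have : restr Ω₁ t t.le_succ ∘ (fun q : (Fin t → Ω₁) × Ω₁ => Fin.snoc q.1 q.2) = Prod.fst :=
    funext fun q => restr_snoc q.1 q.2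
  rw [this]
  exact Measure.fst_compProd _ _

theorem ae_extend_iff {E : Type*} [MeasurableSpace E] [MeasurableSpace.CountablyGenerated E]
    [Nonempty E]
    (hκ : Measurable[univComp (Fin t → Ω₁), borel (ProbabilityMeasure Ω₁)] κ)
    {y : (Fin t → Ω₁) → E} (hy : Measurable[univComp (Fin t → Ω₁)] y)
    {B : Set (E × (Fin (t + 1) → Ω₁))} (hB : MeasurableSet B) :
    (∀ᵐ z ∂extend ν κ,
        (y (restr Ω₁ t t.le_succ z), z) ∈ B) ↔
      ∀ᵐ ω ∂ν, ∀ᵐ x ∂(κ ω : Measure Ω₁), (y ω, Fin.snoc ω x) ∈ B := by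
  obtain ⟨y', hy', hyy'⟩ := (nullMeasurable_of_univComp hy ν).aemeasurable
  have hmarg := map_restr_extend (ν := ν) hκ
  obtain ⟨κ', hκ', hκκ', he⟩ := exists_extend_eq_map (ν := ν) hκ
  rw [he] at hmarg ⊢
  have hyr : ∀ᵐ z ∂(ν.compProd (kernelOf κ' hκ')).map fun q => Fin.snoc q.1 q.2,
      y (restr Ω₁ t t.le_succ z) = y' (restr Ω₁ t t.le_succ z) :=
    ae_of_ae_map (measurable_restr _).aemeasurable (hmarg.symm ▸ hyy')
  have hB₁ : MeasurableSet {z : Fin (t + 1) → Ω₁ | (y' (restr Ω₁ t t.le_succ z), z) ∈ B} :=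
    ((hy'.comp (measurable_restr _)).prodMk measurable_id) hB
  have hB₂ : MeasurableSet {q : (Fin t → Ω₁) × Ω₁ | (y' q.1, Fin.snoc q.1 q.2) ∈ B} :=
    ((hy'.comp measurable_fst).prodMk measurable_snoc) hB
  rw [eventually_congr (hyr.mono fun z hz => by rw [hz]),
    ae_map_iff measurable_snoc.aemeasurable hB₁]
  simp only [restr_snoc]
  rw [Measure.ae_compProd_iff hB₂]
  refine eventually_congr ?_
  filter_upwards [hyy', hκκ'] with ω h₁ h₂
  rw [h₁, h₂]
  rfl

end Extension

/-! ### The family of product measures -/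

section MeasFam

variable {Ω₁ : Type} [MeasurableSpace Ω₁] [TopologicalSpace Ω₁] [BorelSpace Ω₁]
  {Pt : (t : ℕ) → (Fin t → Ω₁) → Set (ProbabilityMeasure Ω₁)}

theorem mem_measFam_succ {t : ℕ} {μ : Measure (Fin (t + 1) → Ω₁)} :
    μ ∈ MeasFam Ω₁ Pt (t + 1) ↔
      ∃ ν ∈ MeasFam Ω₁ Pt t, ∃ κ : (Fin t → Ω₁) → ProbabilityMeasure Ω₁,
        Measurable[univComp (Fin t → Ω₁), borel (ProbabilityMeasure Ω₁)] κ ∧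
        (∀ ω, κ ω ∈ Pt t ω) ∧ μ = extend ν κ :=
  Iff.rfl

variable [PolishSpace Ω₁]

theorem isProbabilityMeasure_of_mem_measFam {t : ℕ} {μ : Measure (Fin t → Ω₁)}
    (hμ : μ ∈ MeasFam Ω₁ Pt t) : IsProbabilityMeasure μ := by
  induction t with
  | zero =>
    obtain rfl : μ = Measure.dirac Fin.elim0 := hμ
    infer_instance
  | succ t ih =>
    obtain ⟨ν, hν, κ, hκ, -, rfl⟩ := mem_measFam_succ.1 hμ
    have := ih hν
    exact isProbabilityMeasure_extend hκ

theorem map_restr_mem_measFam {T s : ℕ} (h : s ≤ T) {μ : Measure (Fin T → Ω₁)}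
    (hμ : μ ∈ MeasFam Ω₁ Pt T) : μ.map (restr Ω₁ s h) ∈ MeasFam Ω₁ Pt s := by
  induction T with
  | zero =>
    obtain rfl : s = 0 := by omega
    exact (Measure.map_id (μ := μ)).symm ▸ hμ
  | succ T ih =>
    rcases h.eq_or_lt with rfl | hlt
    · exact (Measure.map_id (μ := μ)).symm ▸ hμ
    · have hsT : s ≤ T := by omega
      obtain ⟨ν, hν, κ, hκ, -, rfl⟩ := mem_measFam_succ.1 hμ
      have := isProbabilityMeasure_of_mem_measFam hν
      have hcomp : restr Ω₁ s h = restr Ω₁ s hsT ∘ restr Ω₁ T T.le_succ := rfl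
      rw [hcomp, ← Measure.map_map (measurable_restr _) (measurable_restr _),
        map_restr_extend hκ]
      exact ih hsT hν

theorem exists_measFam_extension {T : ℕ}
    (hne : ∀ t, t < T → ∀ ω, (Pt t ω).Nonempty)
    (hgraph : ∀ t, t < T →
      AnalyticSet {p : (Fin t → Ω₁) × ProbabilityMeasure Ω₁ | p.2 ∈ Pt t p.1})
    {s : ℕ} (h : s ≤ T) {μ : Measure (Fin s → Ω₁)} (hμ : μ ∈ MeasFam Ω₁ Pt s) :
    ∃ P ∈ MeasFam Ω₁ Pt T, P.map (restr Ω₁ s h) = μ := by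
  induction T, h using Nat.le_induction with
  | base => exact ⟨μ, hμ, Measure.map_id⟩
  | succ T hsT ih =>
    obtain ⟨P, hP, hPμ⟩ := ih (fun t ht => hne t (by omega)) fun t ht => hgraph t (by omega)
    have := isProbabilityMeasure_of_mem_measFam hP
    obtain ⟨κ, hκ, hκPt⟩ := exists_measurable_selector_of_nonempty (hgraph T T.lt_succ_self)
      (hne T T.lt_succ_self)
    refine ⟨extend P κ, ⟨P, hP, κ, hκ, hκPt, rfl⟩, ?_⟩
    have hcomp : restr Ω₁ s (hsT.trans T.le_succ) = restr Ω₁ s hsT ∘ restr Ω₁ T T.le_succ := rfl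
    rw [hcomp, ← Measure.map_map (measurable_restr _) (measurable_restr _),
      map_restr_extend hκ, hPμ]

end MeasFam

/-! ### Trading over a single period -/

section SinglePeriod

variable {Ω₁ : Type} {d : ℕ}

/-- The gain from holding a portfolio over the last period of a path of length `t + 1`. -/
def lastGain (S : (t : ℕ) → (Fin t → Ω₁) → Fin d → ℝ) (t : ℕ)
    (q : (Fin d → ℝ) × (Fin (t + 1) → Ω₁)) : ℝ :=
  ∑ i, q.1 i * (S (t + 1) q.2 i - S t (restr Ω₁ t t.le_succ q.2) i)

variable {S : (t : ℕ) → (Fin t → Ω₁) → Fin d → ℝ}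

theorem gain_update {T t : ℕ} (ht : t < T) (y : (Fin t → Ω₁) → Fin d → ℝ) (ω : Fin T → Ω₁) :
    gain Ω₁ S (Function.update (fun _ _ => 0) t y) T le_rfl ω =
      lastGain S t (y (restr Ω₁ t ht.le ω), restr Ω₁ (t + 1) ht ω) := by
  rw [gain, Finset.sum_eq_single (⟨t, ht⟩ : Fin T)]
  · simp only [Function.update_self]
    rfl
  · intro u _ hu
    have hut : (u : ℕ) ≠ t := fun h => hu (Fin.ext h)
    simp [Function.update_of_ne hut]
  · simp

variable [MeasurableSpace Ω₁]

theorem lastGain_snoc [TopologicalSpace Ω₁] [OpensMeasurableSpace Ω₁] {t : ℕ} (y : Fin d → ℝ)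
    (ω : Fin t → Ω₁) (x : Ω₁) :
    lastGain S t (y, Fin.snoc ω x) = ∑ i, y i * incr Ω₁ S t ω x i := by
  simp only [lastGain, restr_snoc, incr]

theorem measurable_lastGain {t : ℕ} (hS : Measurable (S t)) (hS' : Measurable (S (t + 1))) :
    Measurable (lastGain S t) := by
  refine Finset.measurable_sum _ fun i _ => Measurable.mul ?_ (Measurable.sub ?_ ?_)
  · exact (measurable_pi_apply i).comp measurable_fst
  · exact (measurable_pi_apply i).comp (hS'.comp measurable_snd)
  · exact (measurable_pi_apply i).comp (hS.comp ((measurable_restr _).comp measurable_snd))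

theorem measurable_incr [TopologicalSpace Ω₁] [OpensMeasurableSpace Ω₁] {t : ℕ}
    (hS : Measurable (S t)) (hS' : Measurable (S (t + 1))) :
    Measurable fun q : (Fin t → Ω₁) × Ω₁ => incr Ω₁ S t q.1 q.2 :=
  measurable_pi_iff.2 fun i =>
    ((measurable_pi_apply i).comp (hS'.comp measurable_snoc)).sub
      ((measurable_pi_apply i).comp (hS.comp measurable_fst))

theorem pred_update {t : ℕ} {y : (Fin t → Ω₁) → Fin d → ℝ}
    (hy : Measurable[univComp (Fin t → Ω₁)] y) :
    Pred Ω₁ d (Function.update (fun _ _ => 0) t y) := by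
  intro u
  rcases eq_or_ne u t with rfl | hu
  · simpa using hy
  · simp [Function.update_of_ne hu]

end SinglePeriod

/-! ### Global no-arbitrage -/

section Polarity

variable {Ω₁ : Type} [MeasurableSpace Ω₁] [TopologicalSpace Ω₁] [PolishSpace Ω₁] [BorelSpace Ω₁]
  {T d : ℕ} {Pt : (t : ℕ) → (Fin t → Ω₁) → Set (ProbabilityMeasure Ω₁)}
  {S : (t : ℕ) → (Fin t → Ω₁) → Fin d → ℝ}

theorem measurable_lastGain_restr {t : ℕ} (hS : Measurable (S t)) (hS' : Measurable (S (t + 1)))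
    {y : (Fin t → Ω₁) → Fin d → ℝ}
    (hy : Measurable[univComp (Fin t → Ω₁)] y) :
    Measurable[univComp (Fin (t + 1) → Ω₁)]
      fun z => lastGain S t (y (restr Ω₁ t t.le_succ z), z) := by
  have hrestr : Measurable[univComp (Fin (t + 1) → Ω₁), univComp (Fin t → Ω₁)]
      (restr Ω₁ t t.le_succ) :=
    measurable_univComp_univComp ((measurable_restr _).mono le_univComp le_rfl)
  have hid : Measurable[univComp (Fin (t + 1) → Ω₁)] (id : (Fin (t + 1) → Ω₁) → _) :=
    measurable_id.mono le_univComp le_rfl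
  exact (measurable_lastGain hS hS').comp
    ((hy.comp hrestr).prodMk hid)

/-- Under no-arbitrage, a strategy over one period which loses under none of the admissible
one-step measures has vanishing gain. -/
theorem NA.lastGain_ae_eq_zero
    (hNA : NA Ω₁ (MeasFam Ω₁ Pt T) S (fun i : Fin 0 => i.elim0))
    (hS : ∀ t, t ≤ T → Measurable (S t)) {t : ℕ} (ht : t < T) {y : (Fin t → Ω₁) → Fin d → ℝ}
    (hy : Measurable[univComp (Fin t → Ω₁)] y)
    (hpos : ∀ ω, ∀ P ∈ Pt t ω, ∀ᵐ x ∂(P : Measure Ω₁), 0 ≤ ∑ i, y ω i * incr Ω₁ S t ω x i)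
    {P : Measure (Fin T → Ω₁)} (hP : P ∈ MeasFam Ω₁ Pt T) :
    ∀ᵐ z ∂P.map (restr Ω₁ (t + 1) ht), lastGain S t (y (restr Ω₁ t t.le_succ z), z) = 0 := by
  have hlast := measurable_lastGain (hS t ht.le) (hS (t + 1) ht)
  have hcomp := measurable_lastGain_restr (hS t ht.le) (hS (t + 1) ht) hy
  have hrestr : Measurable[univComp (Fin T → Ω₁), univComp (Fin (t + 1) → Ω₁)]
      (restr Ω₁ (t + 1) ht) :=
    measurable_univComp_univComp ((measurable_restr _).mono le_univComp le_rfl)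
  have hgain : Measurable[univComp (Fin T → Ω₁)] fun ω : Fin T → Ω₁ =>
      lastGain S t (y (restr Ω₁ t ht.le ω), restr Ω₁ (t + 1) ht ω) := hcomp.comp hrestr
  have key := hNA _ (pred_update hy) Fin.elim0
  simp only [gain_update ht, Finset.univ_eq_empty, Finset.sum_empty, add_zero] at key
  rw [quasiSure_iff (p := fun ω => 0 ≤ lastGain S t (y (restr Ω₁ t ht.le ω), restr Ω₁ (t + 1) ht ω))
      (hgain measurableSet_Ici).compl,
    quasiSure_iff (p := fun ω => lastGain S t (y (restr Ω₁ t ht.le ω), restr Ω₁ (t + 1) ht ω) = 0)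
      (hgain (measurableSet_singleton 0)).compl] at key
  have hzero := key (fun Q hQ => by
    obtain ⟨ν, hν, κ, hκ, hκPt, hQν⟩ := mem_measFam_succ.1 (map_restr_mem_measFam ht hQ)
    have := isProbabilityMeasure_of_mem_measFam hν
    have hae := (ae_extend_iff (ν := ν) hκ hy (hlast measurableSet_Ici)).2
      (ae_of_all _ fun ω => (hpos ω _ (hκPt ω)).mono fun x hx => by
        simpa only [mem_preimage, mem_Ici, lastGain_snoc] using hx)
    rw [← hQν] at hae
    exact ae_of_ae_map (measurable_restr _).aemeasurable hae) P hP
  have := isProbabilityMeasure_of_mem_measFam hP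
  have := isProbabilityMeasure_of_mem_measFam (map_restr_mem_measFam ht hP)
  have hnull := (hcomp (measurableSet_singleton 0)).compl (P.map (restr Ω₁ (t + 1) ht))
    inferInstance
  rw [ae_iff]
  exact (Measure.map_apply₀ (measurable_restr _).aemeasurable hnull).trans hzero

/-- A selector of `Pt t` charging the event that `y` has positive gain, at almost every history at
which some element of `Pt t` does. -/
theorem exists_selector_charging {t : ℕ} (hne : ∀ ω, (Pt t ω).Nonempty)
    (hgraph : AnalyticSet {p : (Fin t → Ω₁) × ProbabilityMeasure Ω₁ | p.2 ∈ Pt t p.1})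
    {Δ : (Fin t → Ω₁) → Ω₁ → Fin d → ℝ}
    (hΔ : Measurable fun q : (Fin t → Ω₁) × Ω₁ => Δ q.1 q.2) {y : (Fin t → Ω₁) → Fin d → ℝ}
    (hy : Measurable[univComp (Fin t → Ω₁)] y) (ν : Measure (Fin t → Ω₁))
    [IsProbabilityMeasure ν] :
    ∃ κ : (Fin t → Ω₁) → ProbabilityMeasure Ω₁,
      Measurable[univComp (Fin t → Ω₁), borel (ProbabilityMeasure Ω₁)] κ ∧
      (∀ ω, κ ω ∈ Pt t ω) ∧
      ∀ᵐ ω ∂ν, (∃ P ∈ Pt t ω, (P : Measure Ω₁) {x | 0 < ∑ i, y ω i * Δ ω x i} ≠ 0) →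
        (κ ω : Measure Ω₁) {x | 0 < ∑ i, y ω i * Δ ω x i} ≠ 0 := by
  classical
  obtain ⟨κ₁, hκ₁, hκ₁Pt⟩ := exists_measurable_selector_of_nonempty hgraph hne
  obtain ⟨y', hy', hyy'⟩ := (nullMeasurable_of_univComp hy ν).aemeasurable
  have hB : MeasurableSet {q : (Fin t → Ω₁) × Ω₁ | 0 < ∑ i, y' q.1 i * Δ q.1 q.2 i} :=
    measurableSet_lt measurable_const (Finset.measurable_sum _ fun i _ =>
      ((measurable_pi_apply i).comp (hy'.comp measurable_fst)).mul
        ((measurable_pi_apply i).comp hΔ))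
  let G := {p : (Fin t → Ω₁) × ProbabilityMeasure Ω₁ | p ∈ {p | p.2 ∈ Pt t p.1} ∧
    (p.2 : Measure Ω₁) {x | 0 < ∑ i, y' p.1 i * Δ p.1 x i} ≠ 0}
  have hG : AnalyticSet G := analyticSet_charge hgraph hB
  have hD := (hG.image_of_continuous continuous_fst).measurableSet_univComp
  have : Nonempty (ProbabilityMeasure Ω₁) := ν.nonempty_of_neZero.map κ₁
  obtain ⟨κ₀, hκ₀, hκ₀G⟩ := hG.exists_measurable_selector
  refine ⟨(Prod.fst '' G).piecewise κ₀ κ₁,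
    @Measurable.piecewise _ _ _ _ _ (univComp _) (borel _) _ hD hκ₀ hκ₁, fun ω => ?_, ?_⟩
  · by_cases hω : ω ∈ Prod.fst '' G
    · rw [piecewise_eq_of_mem _ _ _ hω]
      exact (hκ₀G ω hω).1
    · rw [piecewise_eq_of_notMem _ _ _ hω]
      exact hκ₁Pt ω
  · filter_upwards [hyy'] with ω hω
    rw [hω]
    rintro ⟨P, hP, hP0⟩
    have hmem : ω ∈ Prod.fst '' G := ⟨(ω, P), ⟨hP, hP0⟩, rfl⟩
    rw [piecewise_eq_of_mem _ _ _ hmem]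
    exact (hκ₀G ω hmem).2

end Polarity

end BN

open BN in
/-- **Polarity of the local no-arbitrage failure set** (Lemma 4.6). For `t < T`, the
set `N_t` of histories `ω ∈ Ω_t` at which the one-period no-arbitrage condition
`NA(𝒫_t(ω))` for the increment `ΔS_{t+1}(ω,·)` fails is universally measurable, and
under `NA(𝒫)` it is `𝒫`-polar. -/
theorem local_no_arbitrage_failure_polar
    (Ω₁ : Type) [MeasurableSpace Ω₁] [TopologicalSpace Ω₁] [PolishSpace Ω₁]
    [BorelSpace Ω₁] [Nonempty Ω₁] (T d : ℕ)
    (Pt : (t : ℕ) → (Fin t → Ω₁) → Set (ProbabilityMeasure Ω₁))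
    (hPtne : ∀ t, t < T → ∀ ω, (Pt t ω).Nonempty)
    (hPtconv : ∀ t, t < T → ∀ ω, ConvexPM (Pt t ω))
    (hPtgraph : ∀ t, t < T →
      AnalyticSet {p : (Fin t → Ω₁) × ProbabilityMeasure Ω₁ | p.2 ∈ Pt t p.1})
    (S : (t : ℕ) → (Fin t → Ω₁) → Fin d → ℝ) (hS : ∀ t, t ≤ T → Measurable (S t))
    (t : ℕ) (ht : t < T) :
    MeasurableSet[univComp (Fin t → Ω₁)]
      {ω : Fin t → Ω₁ | ¬ NA1
        ((fun P : ProbabilityMeasure Ω₁ => (P : Measure Ω₁)) '' Pt t ω)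
        (incr Ω₁ S t ω)} ∧
    (NA Ω₁ (MeasFam Ω₁ Pt T) S (fun i : Fin 0 => i.elim0) →
      IsPolar (MeasFam Ω₁ Pt T) (univComp (Fin T → Ω₁))
        {ω : Fin T → Ω₁ | ¬ NA1
          ((fun P : ProbabilityMeasure Ω₁ => (P : Measure Ω₁)) '' Pt t (restr Ω₁ t ht.le ω))
          (incr Ω₁ S t (restr Ω₁ t ht.le ω))}) := by
  have hS₁ := hS t ht.le
  have hS₂ := hS (t + 1) ht
  have hincr := measurable_incr hS₁ hS₂
  have hiff : ∀ ω : Fin t → Ω₁,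
      ¬ NA1 ((fun P : ProbabilityMeasure Ω₁ => (P : Measure Ω₁)) '' Pt t ω) (incr Ω₁ S t ω) ↔
        ∃ y, IsArbitrage (Pt t ω) (incr Ω₁ S t ω) y := fun ω =>
    not_NA1_iff (hincr.comp measurable_prodMk_left)
  simp only [hiff]
  obtain ⟨hN, Y, hY, hYarb⟩ := exists_measurable_arbitrage (hPtgraph t ht) hincr
  refine ⟨hN, fun hNA => ?_⟩
  set N := {ω : Fin t → Ω₁ | ∃ y, IsArbitrage (Pt t ω) (incr Ω₁ S t ω) y}
  let y : (Fin t → Ω₁) → Fin d → ℝ := N.indicator Y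
  have hy : Measurable[univComp (Fin t → Ω₁)] y := hY.indicator hN
  have hyN : ∀ ω ∈ N, IsArbitrage (Pt t ω) (incr Ω₁ S t ω) (y ω) := fun ω hω => by
    simpa only [y, indicator_of_mem hω] using hYarb ω hω
  have hpos : ∀ ω, ∀ P ∈ Pt t ω, ∀ᵐ x ∂(P : Measure Ω₁),
      0 ≤ ∑ i, y ω i * incr Ω₁ S t ω x i := by
    intro ω P hP
    by_cases hω : ω ∈ N
    · simpa only [ae_iff, not_le] using (hyN ω hω).1 P hP
    · simp [y, indicator_of_notMem hω]
  have hrestr : Measurable[univComp (Fin T → Ω₁), univComp (Fin t → Ω₁)] (restr Ω₁ t ht.le) :=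
    measurable_univComp_univComp ((measurable_restr _).mono le_univComp le_rfl)
  refine ⟨restr Ω₁ t ht.le ⁻¹' N, hrestr hN, subset_rfl, fun P hP => ?_⟩
  have hν := map_restr_mem_measFam ht.le hP
  have hνprob := isProbabilityMeasure_of_mem_measFam hν
  rw [← Measure.map_apply₀ (measurable_restr _).aemeasurable (hN _ hνprob)]
  obtain ⟨κ, hκ, hκPt, hcharge⟩ :=
    exists_selector_charging (hPtne t ht) (hPtgraph t ht) hincr hy (P.map (restr Ω₁ t ht.le))
  obtain ⟨P', hP', hP'eq⟩ := exists_measFam_extension hPtne hPtgraph (Nat.succ_le_of_lt ht)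
    (mem_measFam_succ.2 ⟨_, hν, κ, hκ, hκPt, rfl⟩)
  have hzero := hNA.lastGain_ae_eq_zero hS ht hy hpos hP'
  rw [hP'eq] at hzero
  have hzero' := (ae_extend_iff hκ hy
    (measurable_lastGain hS₁ hS₂ (measurableSet_singleton 0))).1 hzero
  rw [measure_eq_zero_iff_ae_notMem]
  filter_upwards [hcharge, hzero'] with ω h₁ h₂ hω
  refine h₁ (hyN ω hω).2 (measure_mono_null (fun x hx => ?_) h₂)
  have hx : 0 < ∑ i, y ω i * incr Ω₁ S t ω x i := hx
  simpa only [mem_compl_iff, mem_ofPred_eq, mem_preimage, mem_singleton_iff, lastGain_snoc]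
    using hx.ne'
end
end
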